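/- arXiv:1409.5923 — 2 statements merged into one kernel-verified Lean document; each statement's English description precedes it below -/
import Mathlib

section
/- For all real numbers d_i > 1, c_i > 0, d_u ≥ 1, c_u > 0, d_l ≥ 1, c_l > 0, c_α > 0 and every α > (max{1, d_i(d_u−1)/(d_i−1)})·d_u − d_l, there exists p_* < 1 (depending only on these constants) such that: for every infinite, connected, locally finite graph G = (V,E) satisfying the local isoperimetric inequality L(d_i,c_i), the volume upper bound V_u(d_u,c_u) and the volume lower bound V_l(d_l,c_l), and for every probability measure P on {0,1}^V satisfying the decoupling inequality D(α,c_α) and with inf_{x ∈ V} P[ω(x)=1] > p_*, the measure P gives probability one to the event that there exists exactly one infinite open cluster. -/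
open MeasureTheory Filter

universe u

variable {V : Type u}

/-- The set of vertices within graph distance `r` of `x`. -/
def gball (G : SimpleGraph V) (x : V) (r : ℝ) : Set V :=
  {y | ∃ p : G.Walk x y, (p.length : ℝ) ≤ r}

/-- The `r`-neighborhood `B(K, r)` of a set `K`. -/
def gnbhd (G : SimpleGraph V) (K : Set V) (r : ℝ) : Set V :=
  {y | ∃ x ∈ K, y ∈ gball G x r}

/-- The edge boundary of `A` relative to `B`, encoded as ordered pairs
`(a, b)` with `a ∈ A`, `b ∈ B \ A` and `a ~ b`. -/
def relBoundary (G : SimpleGraph V) (A B : Set V) : Set (V × V) :=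
  {e | G.Adj e.1 e.2 ∧ e.1 ∈ A ∧ e.2 ∈ B ∧ e.2 ∉ A}

/-- The edge boundary of `A`, encoded as ordered pairs `(a, b)` with
`a ∈ A`, `b ∉ A` and `a ~ b`. -/
def bdry (G : SimpleGraph V) (A : Set V) : Set (V × V) :=
  {e | G.Adj e.1 e.2 ∧ e.1 ∈ A ∧ e.2 ∉ A}

/-- The local isoperimetric inequality `L(dᵢ, cᵢ)`. -/
def LocalIso (G : SimpleGraph V) (di ci : ℝ) : Prop :=
  ∀ (x : V) (r : ℝ), 1 ≤ r → ∀ A : Set V, A ⊆ gball G x r →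
    (A.ncard : ℝ) ≤ (gball G x r).ncard / 2 →
    ci * (A.ncard : ℝ) ^ ((di - 1) / di) ≤ ((relBoundary G A (gball G x r)).ncard : ℝ)

/-- The volume upper bound `𝒱ᵤ(dᵤ, cᵤ)`. -/
def VolUpper (G : SimpleGraph V) (du cu : ℝ) : Prop :=
  ∀ (x : V) (r : ℝ), 1 ≤ r →
    (gball G x r).Finite ∧ ((gball G x r).ncard : ℝ) ≤ cu * r ^ du

/-- The volume lower bound `𝒱ₗ(dₗ, cₗ)`. -/
def VolLower (G : SimpleGraph V) (dl cl : ℝ) : Prop :=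
  ∀ (x : V) (r : ℝ), 1 ≤ r → cl * r ^ dl ≤ ((gball G x r).ncard : ℝ)

/-- Every walk from `y` to `z` has length at least `t`; equivalently the graph
distance from `y` to `z` (with value `∞` if unreachable) is at least `t`. -/
def distGE (G : SimpleGraph V) (y z : V) (t : ℝ) : Prop :=
  ∀ p : G.Walk y z, t ≤ (p.length : ℝ)

/-- The distance between the sets `A` and `B` is at least `t`. -/
def setDistGE (G : SimpleGraph V) (A B : Set V) (t : ℝ) : Prop :=
  ∀ a ∈ A, ∀ b ∈ B, distGE G a b t

/-- The diameter of `A` is at least `t`. -/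
def diamGE (G : SimpleGraph V) (A : Set V) (t : ℝ) : Prop :=
  ∃ y ∈ A, ∃ z ∈ A, distGE G y z t

/-- The diameter of `A` is at most `t`. -/
def diamLE (G : SimpleGraph V) (A : Set V) (t : ℝ) : Prop :=
  ∀ y ∈ A, ∀ z ∈ A, ∃ p : G.Walk y z, (p.length : ℝ) ≤ t

/-- `A` is a connected set of vertices. -/
def ConnSet (G : SimpleGraph V) (A : Set V) : Prop := (G.induce A).Connected

/-- There is an open path, all of whose vertices lie in `S`, connecting `A` to `A'`:
its first vertex lies in `B(A,1)` and its last vertex in `B(A',1)`. -/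
def ConnectsIn (G : SimpleGraph V) (ω : V → Bool) (A A' S : Set V) : Prop :=
  ∃ (a b : V) (p : G.Walk a b), a ∈ gnbhd G A 1 ∧ b ∈ gnbhd G A' 1 ∧
    (∀ v ∈ p.support, v ∈ S) ∧ (∀ v ∈ p.support, ω v = true)

/-- The separation event `𝒮(x, L)`. -/
def sep (G : SimpleGraph V) (ω : V → Bool) (x : V) (L : ℝ) : Prop :=
  ∃ A B : Set V, A ⊆ gball G x (3 * L / 6) ∧ B ⊆ gball G x (3 * L / 6) ∧
    ConnSet G A ∧ ConnSet G B ∧ setDistGE G A B 2 ∧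
    diamGE G A (L / 100) ∧ diamGE G B (L / 100) ∧
    ¬ ConnectsIn G ω A B (gball G x L)

/-- The open cluster `𝒞ₓ` of `x` (empty when `x` is closed). -/
def openCluster (G : SimpleGraph V) (ω : V → Bool) (x : V) : Set V :=
  {y | ω x = true ∧ ∃ p : G.Walk x y, ∀ v ∈ p.support, ω v = true}

/-- There is exactly one infinite open cluster. -/
def UniqueInfCluster (G : SimpleGraph V) (ω : V → Bool) : Prop :=
  (∃ x, (openCluster G ω x).Infinite) ∧
    ∀ x y, (openCluster G ω x).Infinite → (openCluster G ω y).Infinite →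
      openCluster G ω x = openCluster G ω y

/-- `P` is the Bernoulli product measure on `{0,1}^V` with parameter `p`, characterized by
its values on cylinder events. -/
def IsBernoulli (P : Measure (V → Bool)) (p : ℝ) : Prop :=
  ∀ (F : Finset V) (η : V → Bool),
    P {ω | ∀ x ∈ F, ω x = η x} =
      ENNReal.ofReal (p ^ (F.filter fun x => η x = true).card *
        (1 - p) ^ (F.filter fun x => η x = false).card)

/-- A decreasing event. -/
def DecreasingEvent (E : Set (V → Bool)) : Prop :=
  ∀ ω ∈ E, ∀ ω' : V → Bool, (∀ x, ω' x ≤ ω x) → ω' ∈ E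

/-- The σ-algebra `σ(Y_z ; z ∈ S)` generated by the coordinates in `S`. -/
def cylσ (S : Set V) : MeasurableSpace (V → Bool) :=
  MeasurableSpace.comap (fun ω => S.restrict ω) MeasurableSpace.pi

/-- The decoupling inequality `𝒟(α, c_α)`. -/
def Decoupling (G : SimpleGraph V) (P : Measure (V → Bool)) (α cα : ℝ) : Prop :=
  ∀ (x : V) (r : ℝ), 1 ≤ r → ∀ E E' : Set (V → Bool),
    DecreasingEvent E → DecreasingEvent E' →
    MeasurableSet[cylσ (gball G x r)] E →
    MeasurableSet[cylσ (gball G x (2 * r))ᶜ] E' →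
    P (E ∩ E') ≤ P E * P E' + ENNReal.ofReal (cα * r ^ (-α))

/-- The scales `L₀ = 10000`, `L_{k+1} = L_k ^ γ`. -/
noncomputable def Lseq (γ : ℝ) : ℕ → ℝ
  | 0 => 10000
  | k + 1 => Lseq γ k ^ γ



section Basics

theorem mem_gball_iff' {G : SimpleGraph V} (hG : G.Connected) (x y : V) (r : ℝ) :
    y ∈ gball G x r ↔ (G.dist x y : ℝ) ≤ r := by
  constructor
  · rintro ⟨p, hp⟩
    have : G.dist x y ≤ p.length := SimpleGraph.dist_le p
    have : (G.dist x y : ℝ) ≤ p.length := by exact_mod_cast this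
    linarith
  · intro h
    obtain ⟨p, hp⟩ := hG.exists_walk_length_eq_dist x y
    exact ⟨p, by rw [hp]; exact h⟩

theorem rtri {G : SimpleGraph V} (hG : G.Connected) (x y z : V) :
    (G.dist x z : ℝ) ≤ G.dist x y + G.dist y z := by
  exact_mod_cast hG.dist_triangle

theorem rsymm {G : SimpleGraph V} (x y : V) :
    (G.dist x y : ℝ) = G.dist y x := by
  rw [SimpleGraph.dist_comm]

theorem ball_fin {G : SimpleGraph V} {du cu : ℝ} (hV : VolUpper G du cu) (x : V) (r : ℝ) :
    (gball G x r).Finite := by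
  refine (hV x (max r 1) (le_max_right _ _)).1.subset ?_
  rintro y ⟨p, hp⟩
  exact ⟨p, hp.trans (le_max_left _ _)⟩

theorem dist_fin {G : SimpleGraph V} (hG : G.Connected) {du cu : ℝ} (hV : VolUpper G du cu)
    (x : V) (r : ℝ) : {y | (G.dist x y : ℝ) ≤ r}.Finite := by
  refine (ball_fin hV x r).subset ?_
  intro y hy
  exact (mem_gball_iff' hG x y r).2 hy

structure Scales (r : ℕ → ℝ) : Prop where
  three : ∀ k, 3 ≤ r k
  grow : ∀ k, 24 * r k ≤ r (k + 1)

theorem Scales.mono {r : ℕ → ℝ} (h : Scales r) : Monotone r := by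
  refine monotone_nat_of_le_succ fun k => ?_
  have := h.three k
  have := h.grow k
  linarith

theorem Scales.lt_grow {r : ℕ → ℝ} (h : Scales r) {m k : ℕ} (hmk : m < k) :
    24 * r m ≤ r k := (h.grow m).trans (h.mono hmk)

theorem Scales.pow_le {r : ℕ → ℝ} (h : Scales r) (k : ℕ) : (2:ℝ) ^ k ≤ r k := by
  induction k with
  | zero => have := h.three 0; simp; linarith
  | succ k ih => have := h.grow k; have := h.three k; rw [pow_succ]; linarith

inductive NB (G : SimpleGraph V) (r : ℕ → ℝ) (M J : ℕ) (ω : V → Bool) : ℕ → V → Prop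
  | base (y : V) : ω y = false → NB G r M J ω 0 y
  | step (m k : ℕ) (y : V) (F : Finset V) : m + 2 ≤ k → k ≤ m + M → NB G r M J ω m y →
      (∀ f ∈ F, NB G r M J ω m f) → F.card = J →
      (∀ f ∈ F, (G.dist y f : ℝ) ≤ 2 * r k) → (∀ f ∈ F, r (k - 1) < (G.dist y f : ℝ)) →
      (∀ f ∈ F, ∀ g ∈ F, f ≠ g → r (k - 1) < (G.dist f g : ℝ)) → NB G r M J ω k y

theorem NB.mono_local {G : SimpleGraph V} (hG : G.Connected) {r : ℕ → ℝ} (hr : Scales r) {M J : ℕ}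
    {ω ω' : V → Bool} {k : ℕ} {y : V} (h : NB G r M J ω k y) :
    (∀ z, (G.dist y z : ℝ) ≤ 4 * r k → ω' z ≤ ω z) → NB G r M J ω' k y := by
  induction h with
  | base y hy =>
    intro hz
    refine NB.base y ?_
    have := hz y (by simp; have := hr.three 0; linarith)
    rw [hy] at this
    exact le_bot_iff.mp this
  | step m k y F h1 h2 _ _ hc h5 h6 h7 ih1 ih2 =>
    intro hz
    have hk := hr.lt_grow (show m < k by omega)
    have h3 := hr.three m
    refine NB.step m k y F h1 h2 (ih1 fun z hz' => hz z (by linarith)) ?_ hc h5 h6 h7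
    intro f hf
    refine ih2 f hf fun z hz' => hz z ?_
    have := h5 f hf
    have := rtri hG y f z
    linarith

theorem NB.not_one {G : SimpleGraph V} {r : ℕ → ℝ} {M J : ℕ}
    {ω : V → Bool} {y : V} : ¬ NB G r M J ω 1 y := by
  intro h
  cases h with
  | step m k F h1 => omega

theorem NB.zero_iff {G : SimpleGraph V} {r : ℕ → ℝ} {M J : ℕ}
    {ω : V → Bool} {y : V} : NB G r M J ω 0 y ↔ ω y = false := by
  constructor
  · intro h
    cases h with
    | base _ h => exact h
    | step m k F h1 => omega
  · exact NB.base y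

end Basics


section Iso

def surf (G : SimpleGraph V) (c : V) (s : ℕ) : Set (V × V) :=
  {e | G.Adj e.1 e.2 ∧ G.dist c e.1 ≤ s ∧ s < G.dist c e.2}

theorem adj_dist_le {G : SimpleGraph V} (hG : G.Connected) (c : V) {u v : V} (h : G.Adj u v) :
    G.dist c v ≤ G.dist c u + 1 := by
  have := hG.dist_triangle (u := c) (v := u) (w := v)
  rw [SimpleGraph.dist_eq_one_iff_adj.2 h] at this
  exact this

theorem surface_lemma {G : SimpleGraph V} (hG : G.Connected) {du cu : ℝ} (hcu : 0 < cu)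
    (hV : VolUpper G du cu) (c : V) (ρ : ℝ) (hρ : 1 ≤ ρ) :
    ∃ s : ℕ, ρ ≤ s ∧ (s : ℝ) ≤ 2 * ρ + 1 ∧ (surf G c s).Finite ∧
      ((surf G c s).ncard : ℝ) ≤ cu ^ 2 * 3 ^ du * ρ ^ (du - 1) := by
  classical
  set n := ⌈ρ⌉₊ with hn
  have hn1 : ρ ≤ n := Nat.le_ceil ρ
  have hn2 : (n : ℝ) < ρ + 1 := Nat.ceil_lt_add_one (by linarith)
  have hnpos : 1 ≤ n := by
    have : (1:ℝ) ≤ n := by linarith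
    exact_mod_cast this
  set B := (dist_fin hG hV c (3 * ρ)).toFinset with hB
  set N : V → Finset V := fun u => (ball_fin hV u 1).toFinset with hN
  set T := B.biUnion (fun u => (N u).image (fun v => (u, v))) with hT
  have hBcard : (B.card : ℝ) ≤ cu * (3 * ρ) ^ du := by
    have h1 := (hV c (3 * ρ) (by linarith)).2
    have h2 : B.card = (gball G c (3 * ρ)).ncard := by
      rw [← Set.ncard_coe_finset]
      congr 1
      ext y
      simp [hB, mem_gball_iff' hG]
    rw [h2]; exact h1
  have hNcard : ∀ u, ((N u).card : ℝ) ≤ cu := by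
    intro u
    have h1 := (hV u 1 le_rfl).2
    have h2 : (N u).card = (gball G u 1).ncard := by
      rw [← Set.ncard_coe_finset]
      congr 1
      simp [hN]
    rw [h2]; simpa using h1
  have hTcard : (T.card : ℝ) ≤ cu * (3 * ρ) ^ du * cu := by
    have h1 : (T.card : ℝ) ≤ ∑ u ∈ B, ((N u).card : ℝ) := by
      have := Finset.card_biUnion_le (s := B) (t := fun u => (N u).image (fun v => (u, v)))
      have h3 : ∑ u ∈ B, ((N u).image (fun v => (u, v))).card ≤ ∑ u ∈ B, (N u).card :=
        Finset.sum_le_sum fun u _ => Finset.card_image_le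
      exact_mod_cast this.trans h3
    have h2 : ∑ u ∈ B, ((N u).card : ℝ) ≤ ∑ u ∈ B, cu := Finset.sum_le_sum fun u _ => hNcard u
    rw [Finset.sum_const, nsmul_eq_mul] at h2
    have := mul_le_mul_of_nonneg_right hBcard hcu.le
    linarith
  have hsub : ∀ s : ℕ, (s : ℝ) ≤ 2 * ρ + 1 → ∀ e ∈ surf G c s, e ∈ T ∧ G.dist c e.1 = s := by
    rintro s hs ⟨u, v⟩ ⟨h1, h2, h3⟩
    dsimp at h1 h2 h3
    have h4 := adj_dist_le hG c h1
    have h5 : G.dist c u = s := by omega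
    refine ⟨?_, h5⟩
    simp only [hT, Finset.mem_biUnion, Finset.mem_image, hB, hN, Set.Finite.mem_toFinset,
      Set.mem_ofPred_eq]
    refine ⟨u, ?_, v, ?_, rfl⟩
    · rw [h5]; linarith
    · rw [mem_gball_iff' hG, SimpleGraph.dist_eq_one_iff_adj.2 h1]; simp
  have hpig : (T.card : ℝ) ≤ (Finset.Ico n (2 * n)).card • (cu ^ 2 * 3 ^ du * ρ ^ (du - 1)) := by
    rw [Nat.card_Ico, nsmul_eq_mul]
    have h1 : ((2 * n - n : ℕ) : ℝ) = n := by congr 1; omega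
    rw [h1]
    have h2 : (3 * ρ) ^ du = 3 ^ du * (ρ ^ (du - 1) * ρ) := by
      rw [Real.mul_rpow (by norm_num) (by linarith)]
      congr 1
      rw [← Real.rpow_add_one (by linarith)]
      congr 1; ring
    have h3 : 0 ≤ cu ^ 2 * 3 ^ du * ρ ^ (du - 1) := by positivity
    calc (T.card : ℝ) ≤ cu * (3 * ρ) ^ du * cu := hTcard
      _ = ρ * (cu ^ 2 * 3 ^ du * ρ ^ (du - 1)) := by rw [h2]; ring
      _ ≤ _ := mul_le_mul_of_nonneg_right hn1 h3
  obtain ⟨s, hs, hs'⟩ := Finset.exists_card_fiber_le_of_card_le_nsmul (f := fun e : V × V => G.dist c e.1)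
    (Finset.nonempty_Ico.2 (by omega)) hpig
  rw [Finset.mem_Ico] at hs
  have hs1 : (n : ℝ) ≤ s := by exact_mod_cast hs.1
  have hs2 : (s : ℝ) + 1 ≤ 2 * n := by exact_mod_cast hs.2
  have hs3 : (s : ℝ) ≤ 2 * ρ + 1 := by linarith
  have hss : surf G c s ⊆ ↑(T.filter fun e => G.dist c e.1 = s) := by
    intro e he
    have := hsub s hs3 e he
    simpa using this
  refine ⟨s, by linarith, hs3, (Finset.finite_toSet _).subset hss, ?_⟩
  refine le_trans ?_ hs'
  have := Set.ncard_le_ncard hss (Finset.finite_toSet _)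
  rw [Set.ncard_coe_finset] at this
  exact_mod_cast this

def SConn (G : SimpleGraph V) (Q : Set V) : Prop :=
  ∀ a ∈ Q, ∀ b ∈ Q, ∃ p : G.Walk a b, ∀ v ∈ p.support, v ∈ Q

def InT (G : SimpleGraph V) (Q : Set V) (b : V) : Prop :=
  b ∈ Q ∧ ∃ a, a ∉ Q ∧ G.Adj a b

theorem walk_ivt {G : SimpleGraph V} (hG : G.Connected) (b : V) {a q : V} (p : G.Walk a q) (i : ℕ)
    (h1 : G.dist b a ≤ i) (h2 : i ≤ G.dist b q) : ∃ v ∈ p.support, G.dist b v = i := by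
  induction p with
  | nil => exact ⟨_, by simp, le_antisymm h1 h2⟩
  | @cons u v w h p ih =>
    by_cases h3 : G.dist b v ≤ i
    · obtain ⟨x, hx, hx'⟩ := ih h3 h2
      exact ⟨x, by simp [hx], hx'⟩
    · have := adj_dist_le hG b h
      exact ⟨u, by simp, by omega⟩

theorem iso_lemma {G : SimpleGraph V} (hG : G.Connected) {di ci du cu : ℝ} (hdi : 1 < di) (hci : 0 < ci)
    (hcu : 0 < cu) (hV : VolUpper G du cu) (hI : LocalIso G di ci)
    (Q : Set V) (hQ : SConn G Q) (hQc : SConn G Qᶜ) (b : V) (hb : InT G Q b) (t ρ : ℝ) (ht : 2 ≤ t)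
    (hρ : 1 ≤ ρ) (C : Finset V) (hq : ∃ q ∈ Q, t ≤ G.dist b q) (hq' : ∃ q, q ∉ Q ∧ t ≤ G.dist b q)
    (hcov : ∀ v, InT G Q v → (G.dist b v : ℝ) ≤ t → ∃ c ∈ C, (G.dist c v : ℝ) ≤ ρ)
    (hn : C.card * (4 * ρ + 3) ≤ t / 2) :
    ci * (t / 2) ^ ((di - 1) / di) ≤ C.card * (cu ^ 2 * 3 ^ du * ρ ^ (du - 1)) := by
  classical
  choose s hs1 hs2 hs3 hs4 using fun c => surface_lemma hG hcu hV c ρ hρ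
  set B := gball G b t with hBdef
  have hBfin : B.Finite := ball_fin hV b t
  have memB : ∀ v, v ∈ B ↔ (G.dist b v : ℝ) ≤ t := fun v => mem_gball_iff' hG b v t
  set F : Set V := {v | v ∈ Q ∧ v ∈ B ∧ ∀ c ∈ C, s c < G.dist c v} with hF
  have hFB : F ⊆ B := fun v hv => hv.2.1
  have hfl : ((⌊t⌋₊ : ℕ) : ℝ) ≤ t := Nat.floor_le (by linarith)
  have hfl2 : t < (⌊t⌋₊ : ℕ) + 1 := Nat.lt_floor_add_one t
  -- lower bound for F
  have hFcard : t / 2 ≤ (F.ncard : ℝ) := by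
    obtain ⟨q, hqQ, hqd⟩ := hq
    obtain ⟨p, hp⟩ := hQ b hb.1 q hqQ
    have hqi : ∀ i : ℕ, i ≤ ⌊t⌋₊ → ∃ v ∈ Q, G.dist b v = i := by
      intro i hi
      obtain ⟨v, hv, hv'⟩ := walk_ivt hG b p i (by simp) (by
        have : (i : ℝ) ≤ ⌊t⌋₊ := by exact_mod_cast hi
        have : (i : ℝ) ≤ G.dist b q := by linarith
        exact_mod_cast this)
      exact ⟨v, hp v hv, hv'⟩
    have : Nonempty V := ⟨b⟩
    choose! f hf1 hf2 using hqi
    have hcardle : Finset.range (⌊t⌋₊ + 1) ⊆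
        (hBfin.subset hFB).toFinset.image (G.dist b) ∪
          C.biUnion (fun c => Finset.Icc (G.dist b c - s c) (G.dist b c + s c)) := by
      intro i hi
      rw [Finset.mem_range] at hi
      have hi' : i ≤ ⌊t⌋₊ := by omega
      rw [Finset.mem_union]
      by_cases hiF : f i ∈ F
      · left
        rw [Finset.mem_image]
        exact ⟨f i, by simpa using hiF, hf2 i hi'⟩
      · right
        have hfiB : f i ∈ B := by
          rw [memB, hf2 i hi']
          have : (i : ℝ) ≤ ⌊t⌋₊ := by exact_mod_cast hi'
          linarith
        have : ∃ c ∈ C, G.dist c (f i) ≤ s c := by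
          by_contra hcon
          push Not at hcon
          exact hiF ⟨hf1 i hi', hfiB, hcon⟩
        obtain ⟨c, hc, hc'⟩ := this
        rw [Finset.mem_biUnion]
        refine ⟨c, hc, ?_⟩
        rw [Finset.mem_Icc]
        have e1 := hG.dist_triangle (u := b) (v := c) (w := f i)
        have e2 := hG.dist_triangle (u := b) (v := f i) (w := c)
        rw [G.dist_comm (u := f i) (v := c)] at e2
        rw [hf2 i hi'] at e1 e2
        omega
    have h1 := Finset.card_le_card hcardle
    rw [Finset.card_range] at h1
    have h2 := h1.trans (Finset.card_union_le _ _)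
    have h3 : ((hBfin.subset hFB).toFinset.image (G.dist b)).card ≤ F.ncard := by
      rw [Set.ncard_eq_toFinset_card F (hBfin.subset hFB)]
      exact Finset.card_image_le
    have h4 : ((C.biUnion (fun c => Finset.Icc (G.dist b c - s c) (G.dist b c + s c))).card : ℝ)
        ≤ C.card * (4 * ρ + 3) := by
      have e1 := Finset.card_biUnion_le (s := C)
        (t := fun c => Finset.Icc (G.dist b c - s c) (G.dist b c + s c))
      have e2 : ((∑ c ∈ C, (Finset.Icc (G.dist b c - s c) (G.dist b c + s c)).card : ℕ) : ℝ) ≤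
          ∑ c ∈ C, (4 * ρ + 3) := by
        push_cast
        refine Finset.sum_le_sum fun c _ => ?_
        rw [Nat.card_Icc]
        have e3 : ((G.dist b c + s c + 1 - (G.dist b c - s c) : ℕ) : ℝ) ≤ ((2 * s c + 1 : ℕ) : ℝ) := by
          exact_mod_cast (by omega)
        push_cast at e3
        have := hs2 c
        linarith
      rw [Finset.sum_const, nsmul_eq_mul] at e2
      refine le_trans ?_ e2
      exact_mod_cast e1
    have h5 : ((⌊t⌋₊ : ℕ) : ℝ) + 1 ≤ F.ncard +
        ((C.biUnion (fun c => Finset.Icc (G.dist b c - s c) (G.dist b c + s c))).card : ℝ) := by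
      exact_mod_cast (by omega : ⌊t⌋₊ + 1 ≤ F.ncard + _)
    linarith
  -- lower bound for the complement
  have hGcard : t / 2 ≤ ((B \ F).ncard : ℝ) := by
    obtain ⟨q, hqQ, hqd⟩ := hq'
    obtain ⟨a, haQ, hab⟩ := hb.2
    obtain ⟨p, hp⟩ := hQc a haQ q hqQ
    have hba : G.dist b a = 1 := SimpleGraph.dist_eq_one_iff_adj.2 hab.symm
    have hsub : Finset.Icc 1 ⌊t⌋₊ ⊆ (hBfin.subset (Set.sdiff_subset (t := F))).toFinset.image (G.dist b) := by
      intro i hi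
      rw [Finset.mem_Icc] at hi
      have hi2 : (i : ℝ) ≤ ⌊t⌋₊ := by exact_mod_cast hi.2
      obtain ⟨v, hv, hv'⟩ := walk_ivt hG b p i (by omega) (by
        have : (i : ℝ) ≤ G.dist b q := by linarith
        exact_mod_cast this)
      rw [Finset.mem_image]
      refine ⟨v, ?_, hv'⟩
      rw [Set.Finite.mem_toFinset]
      refine ⟨?_, fun hvF => hp v hv hvF.1⟩
      rw [memB, hv']; linarith
    have h1 := (Finset.card_le_card hsub).trans Finset.card_image_le
    rw [← Set.ncard_eq_toFinset_card (B \ F) (hBfin.subset (Set.sdiff_subset (t := F))), Nat.card_Icc] at h1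
    have h2 : ((⌊t⌋₊ : ℕ) : ℝ) ≤ (B \ F).ncard := by exact_mod_cast (by omega : ⌊t⌋₊ ≤ (B \ F).ncard)
    linarith
  -- boundary
  have key : ∀ u v, G.Adj u v → u ∈ F → v ∈ B → v ∉ F → ∃ c ∈ C, (v, u) ∈ surf G c (s c) := by
    intro u v huv hu hv hvF
    by_cases hvQ : v ∈ Q
    · have : ∃ c ∈ C, G.dist c v ≤ s c := by
        by_contra hcon
        push Not at hcon
        exact hvF ⟨hvQ, hv, hcon⟩
      obtain ⟨c, hc, hc'⟩ := this
      exact ⟨c, hc, huv.symm, hc', hu.2.2 c hc⟩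
    · exfalso
      obtain ⟨c, hc, hc'⟩ := hcov u ⟨hu.1, v, hvQ, huv.symm⟩ ((memB u).1 hu.2.1)
      have h1 := hu.2.2 c hc
      have h2 := hs1 c
      have h3 : ((s c : ℕ) : ℝ) < G.dist c u := by exact_mod_cast h1
      linarith
  set S : Finset (V × V) := C.biUnion (fun c => (hs3 c).toFinset) with hS
  have hScard : (S.card : ℝ) ≤ C.card * (cu ^ 2 * 3 ^ du * ρ ^ (du - 1)) := by
    have e1 := Finset.card_biUnion_le (s := C) (t := fun c => (hs3 c).toFinset)
    have e2 : ((∑ c ∈ C, ((hs3 c).toFinset).card : ℕ) : ℝ) ≤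
        ∑ c ∈ C, (cu ^ 2 * 3 ^ du * ρ ^ (du - 1)) := by
      push_cast
      refine Finset.sum_le_sum fun c _ => ?_
      rw [← Set.ncard_eq_toFinset_card _ (hs3 c)]
      exact hs4 c
    rw [Finset.sum_const, nsmul_eq_mul] at e2
    refine le_trans ?_ e2
    exact_mod_cast e1
  have hθ : 0 ≤ (di - 1) / di := div_nonneg (by linarith) (by linarith)
  have fin : ∀ A : Set V, A ⊆ B → t / 2 ≤ (A.ncard : ℝ) → (A.ncard : ℝ) ≤ (B.ncard : ℝ) / 2 →
      ((relBoundary G A B).ncard : ℝ) ≤ S.card → 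
      ci * (t / 2) ^ ((di - 1) / di) ≤ C.card * (cu ^ 2 * 3 ^ du * ρ ^ (du - 1)) := by
    intro A hA h1 h2 h3
    have h4 := hI b t (by linarith) A hA h2
    have h5 := Real.rpow_le_rpow (by linarith) h1 hθ
    have h6 := mul_le_mul_of_nonneg_left h5 hci.le
    linarith
  have hsum : (B \ F).ncard + F.ncard = B.ncard := Set.ncard_sdiff_add_ncard_of_subset hFB hBfin
  have hsum' : ((B \ F).ncard : ℝ) + F.ncard = B.ncard := by exact_mod_cast hsum
  by_cases hc : (F.ncard : ℝ) ≤ (B.ncard : ℝ) / 2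
  · refine fin F hFB hFcard hc ?_
    have : relBoundary G F B ⊆ ↑(S.image Prod.swap) := by
      rintro ⟨u, v⟩ ⟨h1, h2, h3, h4⟩
      obtain ⟨c, hc, hc'⟩ := key u v h1 h2 h3 h4
      rw [Finset.mem_coe, Finset.mem_image]
      exact ⟨(v, u), Finset.mem_biUnion.2 ⟨c, hc, by simpa using hc'⟩, rfl⟩
    have h1 := Set.ncard_le_ncard this (Finset.finite_toSet _)
    rw [Set.ncard_coe_finset] at h1
    exact_mod_cast h1.trans Finset.card_image_le
  · refine fin (B \ F) Set.sdiff_subset hGcard (by push Not at hc; linarith) ?_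
    have : relBoundary G (B \ F) B ⊆ ↑S := by
      rintro ⟨v, u⟩ ⟨h1, h2, h3, h4⟩
      have hu : u ∈ F := by
        by_contra hu
        exact h4 ⟨h3, hu⟩
      obtain ⟨c, hc, hc'⟩ := key u v h1.symm hu h2.1 h2.2
      exact Finset.mem_biUnion.2 ⟨c, hc, by simpa using hc'⟩
    have h1 := Set.ncard_le_ncard this (Finset.finite_toSet _)
    rw [Set.ncard_coe_finset] at h1
    exact_mod_cast h1

end Iso


section Det

theorem cover_lemma {G : SimpleGraph V} (hG : G.Connected) {du cu : ℝ} (hV : VolUpper G du cu)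
    {r : ℕ → ℝ} (hr : Scales r) {M J : ℕ} {ω : V → Bool} (q : ℕ) :
    ∀ (i : ℕ) (x : V) (P : Set V), (∀ y ∈ P, NB G r M J ω q y) →
      (∀ y ∈ P, ∀ k, q < k → ¬ NB G r M J ω k y) →
      (∀ y ∈ P, (G.dist x y : ℝ) ≤ r (q + 1 + i)) → 1 + i ≤ M →
      ∃ C : Finset V, C.card ≤ J ^ i ∧ ∀ y ∈ P, ∃ c ∈ C, (G.dist c y : ℝ) ≤ r (q + 1) := by
  classical
  intro i
  induction i with
  | zero =>
    intro x P _ _ h3 _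
    exact ⟨{x}, by simp, fun y hy => ⟨x, by simp, h3 y hy⟩⟩
  | succ i ih =>
    intro x P h1 h2 h3 hM
    have hPfin : P.Finite := (dist_fin hG hV x (r (q + 1 + (i + 1)))).subset h3
    set P' := hPfin.toFinset with hP'
    let Sep : Finset V → Prop := fun F => ∀ f ∈ F, ∀ g ∈ F, f ≠ g → r (q + 1 + i) < (G.dist f g : ℝ)
    have hne : (P'.powerset.filter Sep).Nonempty := ⟨∅, by simp [Sep]⟩
    obtain ⟨F, hF, hFmax⟩ := Finset.exists_max_image _ Finset.card hne
    rw [Finset.mem_filter, Finset.mem_powerset] at hF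
    have hFP : ∀ f ∈ F, f ∈ P := fun f hf => by simpa [hP'] using hF.1 hf
    have hcard : F.card ≤ J := by
      by_contra hcon
      push Not at hcon
      obtain ⟨y, hy⟩ : F.Nonempty := Finset.card_pos.1 (by omega)
      have : J ≤ (F.erase y).card := by rw [Finset.card_erase_of_mem hy]; omega
      obtain ⟨F', hF', hF'c⟩ := Finset.exists_subset_card_eq this
      refine h2 y (hFP y hy) (q + 1 + (i + 1)) (by omega) ?_
      refine NB.step q _ y F' (by omega) (by omega) (h1 y (hFP y hy))
        (fun f hf => h1 f (hFP f (Finset.mem_of_mem_erase (hF' hf)))) hF'c ?_ ?_ ?_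
      · intro f hf
        have e1 := h3 y (hFP y hy)
        have e2 := h3 f (hFP f (Finset.mem_of_mem_erase (hF' hf)))
        have e3 := rtri hG y x f
        rw [rsymm y x] at e3
        linarith
      · intro f hf
        have e := hF' hf
        rw [Finset.mem_erase] at e
        exact hF.2 y hy f e.2 (Ne.symm e.1)
      · intro f hf g hg hfg
        exact hF.2 f (Finset.mem_of_mem_erase (hF' hf)) g (Finset.mem_of_mem_erase (hF' hg)) hfg
    have hcov : ∀ y ∈ P, ∃ f ∈ F, (G.dist f y : ℝ) ≤ r (q + 1 + i) := by
      intro y hy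
      by_contra hcon
      push Not at hcon
      by_cases hyF : y ∈ F
      · have e := hcon y hyF
        have e0 : (G.dist y y : ℝ) = 0 := by simp
        have := hr.three (q + 1 + i)
        linarith
      · have hins : insert y F ∈ P'.powerset.filter Sep := by
          rw [Finset.mem_filter, Finset.mem_powerset]
          refine ⟨Finset.insert_subset (by simpa [hP'] using hy) hF.1, ?_⟩
          intro f hf g hg hfg
          rw [Finset.mem_insert] at hf hg
          rcases hf with rfl | hf <;> rcases hg with rfl | hg
          · exact absurd rfl hfg
          · rw [rsymm]; exact hcon g hg
          · exact hcon f hf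
          · exact hF.2 f hf g hg hfg
        have := hFmax _ hins
        rw [Finset.card_insert_of_notMem hyF] at this
        omega
    have hih : ∀ f : V, ∃ C : Finset V, C.card ≤ J ^ i ∧
        ∀ y ∈ {y | y ∈ P ∧ (G.dist f y : ℝ) ≤ r (q + 1 + i)}, ∃ c ∈ C, (G.dist c y : ℝ) ≤ r (q + 1) :=
      fun f => ih f {y | y ∈ P ∧ (G.dist f y : ℝ) ≤ r (q + 1 + i)} (fun y hy => h1 y hy.1)
        (fun y hy => h2 y hy.1) (fun y hy => hy.2) (by omega)
    choose C hC1 hC2 using hih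
    refine ⟨F.biUnion C, ?_, ?_⟩
    · refine (Finset.card_biUnion_le_card_mul F C (J ^ i) fun f _ => hC1 f).trans ?_
      rw [pow_succ, mul_comm]
      exact Nat.mul_le_mul_left _ hcard
    · intro y hy
      obtain ⟨f, hf, hf'⟩ := hcov y hy
      obtain ⟨c, hc, hc'⟩ := hC2 f y ⟨hy, hf'⟩
      exact ⟨c, Finset.mem_biUnion.2 ⟨f, hf, hc⟩, hc'⟩

end Det


section Claim

structure IsoCond (r : ℕ → ℝ) (M J : ℕ) (di ci du cu : ℝ) : Prop where
  hM : 3 ≤ M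
  hJ : 1 ≤ J
  growM : ∀ k, 2 * M * r k ≤ r (k + 1)
  cond1 : ∀ m, ((1 + J ^ M) ^ M : ℕ) * (4 * (2 * r (m + 1)) + 3) ≤ r (m + M - 1) / 2 / 2
  cond2 : ∀ m, ((1 + J ^ M) ^ M : ℕ) * (cu ^ 2 * 3 ^ du * (2 * r (m + 1)) ^ (du - 1)) <
    ci * (r (m + M - 1) / 2 / 2) ^ ((di - 1) / di)

theorem claim {G : SimpleGraph V} (hG : G.Connected) {di ci du cu : ℝ} (hdi : 1 < di) (hci : 0 < ci)
    (hcu : 0 < cu) (hV : VolUpper G du cu) (hI : LocalIso G di ci)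
    {r : ℕ → ℝ} (hr : Scales r) {M J : ℕ} (hC : IsoCond r M J di ci du cu) {ω : V → Bool}
    (Q : Set V) (hQ : SConn G Q) (hQc : SConn G Qᶜ) (hclosed : ∀ b, InT G Q b → ω b = false)
    (b0 : V) (D : ℝ)
    (hyp : ∀ b, InT G Q b → (G.dist b0 b : ℝ) ≤ D →
      (∃ q ∈ Q, D ≤ G.dist b q) ∧ (∃ q, q ∉ Q ∧ D ≤ G.dist b q)) :
    ∀ (m : ℕ) (b : V), InT G Q b → (G.dist b0 b : ℝ) + r (m + M - 1) ≤ D →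
      ∃ b', InT G Q b' ∧ (G.dist b b' : ℝ) ≤ r (m + M - 1) ∧ ∃ k, m < k ∧ NB G r M J ω k b' := by
  classical
  intro m
  induction m using Nat.strong_induction_on with
  | _ m IH =>
  intro b hb hbD
  by_contra hcon
  push Not at hcon
  have hM := hC.hM
  have hJ := hC.hJ
  set τ := r (m + M - 1) with hτ
  set τ' := r (m + M - 2) with hτ'
  have hτ'3 : 3 ≤ τ' := hr.three _
  have hgM : 2 * M * τ' ≤ τ := by
    have := hC.growM (m + M - 2)
    rw [show m + M - 2 + 1 = m + M - 1 by omega] at this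
    exact this
  have hM3 : (3:ℝ) ≤ M := by exact_mod_cast hM
  have hJpow : ∀ i, i ≤ M → J ^ i ≤ J ^ M := fun i hi => Nat.pow_le_pow_right hJ hi
  -- covering statement
  have cov : ∀ i, i ≤ m → i + 2 ≤ M → ∃ C : Finset V, C.card ≤ (1 + J ^ M) ^ (i + 1) ∧
      ∀ y, InT G Q y → (G.dist b y : ℝ) ≤ τ - i * τ' → (∃ k, m - i ≤ k ∧ NB G r M J ω k y) →
        ∃ c ∈ C, (G.dist c y : ℝ) ≤ r (m + 1) := by
    intro i
    induction i with
    | zero =>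
      intro _ _
      obtain ⟨C, hC1, hC2⟩ := cover_lemma hG hV hr (M := M) (J := J) (ω := ω) m (M - 2) b
        {y | InT G Q y ∧ (G.dist b y : ℝ) ≤ τ ∧ NB G r M J ω m y}
        (fun y hy => hy.2.2) (fun y hy k hk => hcon y hy.1 hy.2.1 k hk)
        (fun y hy => by rw [show m + 1 + (M - 2) = m + M - 1 by omega]; exact hy.2.1) (by omega)
      refine ⟨C, ?_, ?_⟩
      · have := hJpow (M - 2) (by omega)
        simp only [zero_add, pow_one]; omega
      · rintro y hy1 hy2 ⟨k, hk1, hk2⟩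
        simp only [Nat.cast_zero, zero_mul, sub_zero] at hy2
        have hkm : k = m := by
          by_contra hne
          exact hcon y hy1 hy2 k (by omega) hk2
        subst hkm
        exact hC2 y ⟨hy1, hy2, hk2⟩
    | succ i ih =>
      intro hi1 hi2
      obtain ⟨C, hC1, hC2⟩ := ih (by omega) (by omega)
      obtain ⟨q, hq⟩ : ∃ q, q = m - (i + 1) := ⟨_, rfl⟩
      have hqi : m - i = q + 1 := by omega
      have h1 : ∀ c : V, ∃ C' : Finset V, C'.card ≤ J ^ (M - 1) ∧
          ∀ y ∈ {y | NB G r M J ω q y ∧ (∀ k, q < k → ¬ NB G r M J ω k y) ∧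
            (G.dist c y : ℝ) ≤ r (q + M)}, ∃ c ∈ C', (G.dist c y : ℝ) ≤ r (q + 1) := by
        intro c
        exact cover_lemma hG hV hr q (M - 1) c _ (fun y hy => hy.1) (fun y hy => hy.2.1)
          (fun y hy => by rw [show q + 1 + (M - 1) = q + M by omega]; exact hy.2.2) (by omega)
      choose C' hC'1 hC'2 using h1
      refine ⟨C ∪ C.biUnion C', ?_, ?_⟩
      · have e1 := Finset.card_union_le C (C.biUnion C')
        have e2 := Finset.card_biUnion_le_card_mul C C' (J ^ (M - 1)) fun c _ => hC'1 c
        have e3 := hJpow (M - 1) (by omega)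
        calc (C ∪ C.biUnion C').card ≤ C.card + C.card * J ^ (M - 1) := by omega
          _ ≤ C.card + C.card * J ^ M := by gcongr
          _ = C.card * (1 + J ^ M) := by ring
          _ ≤ (1 + J ^ M) ^ (i + 1) * (1 + J ^ M) := Nat.mul_le_mul_right _ hC1
          _ = _ := by rw [← pow_succ]
      · rintro y hy1 hy2 ⟨k, hk1, hk2⟩
        push_cast at hy2
        by_cases hup : ∃ k, q + 1 ≤ k ∧ NB G r M J ω k y
        · rw [← hqi] at hup
          obtain ⟨c, hc, hc'⟩ := hC2 y hy1 (by nlinarith) hup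
          exact ⟨c, Finset.mem_union_left _ hc, hc'⟩
        · push Not at hup
          have hkq : k = q := by
            by_contra hne
            exact hup k (by omega) hk2
          subst hkq
          have hq1 : r (k + M - 1) ≤ τ' := hr.mono (by omega)
          have tri := rtri hG b0 b y
          have hi0 : (0:ℝ) ≤ i * τ' := by positivity
          obtain ⟨y', hy'1, hy'2, k', hk'1, hk'2⟩ := IH k (by omega) y hy1 (by nlinarith)
          have tri2 := rtri hG b y y'
          obtain ⟨c, hc, hc'⟩ := hC2 y' hy'1 (by nlinarith) ⟨k', by omega, hk'2⟩
          have tri3 := rtri hG c y' y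
          rw [rsymm y' y] at tri3
          have e1 : r (m + 1) ≤ r (k + M - 1) := hr.mono (by omega)
          have e2 := hr.lt_grow (show k + M - 1 < k + M by omega)
          have e3 := hr.three (k + M - 1)
          obtain ⟨c', hc'1, hc'2⟩ := hC'2 c y ⟨hk2, fun k' hk' => hup k' (by omega), by linarith⟩
          refine ⟨c', Finset.mem_union_right _ (Finset.mem_biUnion.2 ⟨c, hc, hc'1⟩), hc'2.trans ?_⟩
          exact hr.mono (by omega)
  have hm3 := hr.three (m + 1)
  have hmm1 := hr.mono (show m ≤ m + 1 by omega)
  -- final cover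
  have fincov : ∃ C : Finset V, C.card ≤ (1 + J ^ M) ^ M ∧
      ∀ y, InT G Q y → (G.dist b y : ℝ) ≤ τ / 2 → ∃ c ∈ C, (G.dist c y : ℝ) ≤ 2 * r (m + 1) := by
    by_cases hmM : m + 2 ≤ M
    · obtain ⟨C, hC1, hC2⟩ := cov m le_rfl hmM
      refine ⟨C, hC1.trans (Nat.pow_le_pow_right (by omega) (by omega)), ?_⟩
      intro y hy1 hy2
      have hmM' : (m:ℝ) ≤ M := by exact_mod_cast (by omega)
      obtain ⟨c, hc, hc'⟩ := hC2 y hy1 (by nlinarith) ⟨0, by omega, NB.base y (hclosed y hy1)⟩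
      exact ⟨c, hc, by linarith⟩
    · obtain ⟨C, hC1, hC2⟩ := cov (M - 2) (by omega) (by omega)
      refine ⟨C, hC1.trans (Nat.pow_le_pow_right (by omega) (by omega)), ?_⟩
      intro y hy1 hy2
      have hcast : ((M - 2 : ℕ) : ℝ) = M - 2 := by rw [Nat.cast_sub (by omega)]; simp
      have tri := rtri hG b0 b y
      have e1 : r (m + 1 - M + M - 1) = r m := by congr 1; omega
      have e2 : r m ≤ τ' := hr.mono (by omega)
      obtain ⟨y', hy'1, hy'2, k', hk'1, hk'2⟩ := IH (m + 1 - M) (by omega) y hy1 (by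
        rw [e1]; nlinarith)
      rw [e1] at hy'2
      have tri2 := rtri hG b y y'
      obtain ⟨c, hc, hc'⟩ := hC2 y' hy'1 (by rw [hcast]; nlinarith) ⟨k', by omega, hk'2⟩
      have tri3 := rtri hG c y' y
      rw [rsymm y' y] at tri3
      exact ⟨c, hc, by linarith⟩
  obtain ⟨C, hCc, hCcov⟩ := fincov
  have hτ0 : 0 < τ := by nlinarith
  have hb' := hyp b hb (by linarith)
  have hdb : (0:ℝ) ≤ G.dist b0 b := by positivity
  obtain ⟨⟨q1, hq1, hq1'⟩, ⟨q2, hq2, hq2'⟩⟩ := hb'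
  have hCc' : (C.card : ℝ) ≤ (((1 + J ^ M) ^ M : ℕ) : ℝ) := by exact_mod_cast hCc
  have c1 := hC.cond1 m
  have c2 := hC.cond2 m
  rw [← hτ] at c1 c2
  have := iso_lemma hG hdi hci hcu hV hI Q hQ hQc b hb (τ / 2) (2 * r (m + 1)) (by nlinarith)
    (by linarith) C ⟨q1, hq1, by linarith⟩ ⟨q2, hq2, by linarith⟩ hCcov
    ((mul_le_mul_of_nonneg_right hCc' (by linarith)).trans c1)
  have e : (C.card : ℝ) * (cu ^ 2 * 3 ^ du * (2 * r (m + 1)) ^ (du - 1)) ≤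
      ((1 + J ^ M) ^ M : ℕ) * (cu ^ 2 * 3 ^ du * (2 * r (m + 1)) ^ (du - 1)) := by
    refine mul_le_mul_of_nonneg_right hCc' ?_
    have : 0 ≤ 2 * r (m + 1) := by linarith
    positivity
  linarith

theorem lemmaX {G : SimpleGraph V} (hG : G.Connected) {di ci du cu : ℝ} (hdi : 1 < di) (hci : 0 < ci)
    (hcu : 0 < cu) (hV : VolUpper G du cu) (hI : LocalIso G di ci)
    {r : ℕ → ℝ} (hr : Scales r) {M J : ℕ} (hC : IsoCond r M J di ci du cu) {ω : V → Bool} (o : V)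
    (good : ∃ k0, ∀ j, k0 ≤ j → ∀ y, (G.dist o y : ℝ) ≤ r (j + M) → ¬ NB G r M J ω j y) :
    ∃ D0 : ℝ, ∀ (Q : Set V), SConn G Q → SConn G Qᶜ → (∀ b, InT G Q b → ω b = false) →
      ∀ (b0 : V) (D : ℝ), InT G Q b0 → D0 ≤ D → (G.dist o b0 : ℝ) ≤ 3 * D →
      (∀ b, InT G Q b → (G.dist b0 b : ℝ) ≤ D →
        (∃ q ∈ Q, D ≤ G.dist b q) ∧ (∃ q, q ∉ Q ∧ D ≤ G.dist b q)) → False := by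
  obtain ⟨k0, hk0⟩ := good
  refine ⟨r (k0 + M - 1), ?_⟩
  intro Q hQ hQc hcl b0 D hb0 hD hob hyp
  have hM := hC.hM
  have hex : ∃ n, D < r (n + M - 1) := by
    obtain ⟨n, hn⟩ := pow_unbounded_of_one_lt D (by norm_num : (1:ℝ) < 2)
    exact ⟨n, hn.trans_le ((hr.pow_le n).trans (hr.mono (by omega)))⟩
  classical
  have hn := Nat.find_spec hex
  have hn' := fun k (hk : k < Nat.find hex) => Nat.find_min hex hk
  generalize Nat.find hex = n at hn hn'
  have hnk : k0 < n := by
    by_contra hcon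
    have := hr.mono (show n + M - 1 ≤ k0 + M - 1 by omega)
    linarith
  obtain ⟨m, rfl⟩ : ∃ m, n = m + 1 := ⟨n - 1, by omega⟩
  have hm := hn' m (by omega)
  push Not at hm
  obtain ⟨b', hb', hbb', k, hk, hNB⟩ := claim hG hdi hci hcu hV hI hr hC Q hQ hQc hcl b0 D hyp m b0 hb0
    (by simpa using hm)
  refine hk0 k (by omega) b' ?_ hNB
  have tri := rtri hG o b0 b'
  have e1 := hr.lt_grow (show m + 1 + M - 1 < k + M by omega)
  have e3 := hr.three (m + M - 1)
  linarith

end Claim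


section Topo

def comp (G : SimpleGraph V) (A : Set V) (x : V) : Set V :=
  {y | ∃ p : G.Walk x y, ∀ v ∈ p.support, v ∉ A}

theorem comp_notMem {G : SimpleGraph V} {A : Set V} {x y : V} (h : y ∈ comp G A x) : y ∉ A := by
  obtain ⟨p, hp⟩ := h
  exact hp y p.end_mem_support

theorem comp_adj {G : SimpleGraph V} {A : Set V} {x y z : V} (h : y ∈ comp G A x) (hyz : G.Adj y z)
    (hz : z ∉ A) : z ∈ comp G A x := by
  obtain ⟨p, hp⟩ := h
  refine ⟨p.append (SimpleGraph.Walk.cons hyz SimpleGraph.Walk.nil), ?_⟩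
  intro v hv
  rw [SimpleGraph.Walk.mem_support_append_iff] at hv
  rcases hv with hv | hv
  · exact hp v hv
  · simp at hv
    rcases hv with rfl | rfl
    · exact hp _ p.end_mem_support
    · exact hz

theorem pathconn {G : SimpleGraph V} {S : Set V} {x : V}
    (h : ∀ y ∈ S, ∃ p : G.Walk x y, ∀ v ∈ p.support, v ∈ S) : SConn G S := by
  intro a ha b hb
  obtain ⟨p, hp⟩ := h a ha
  obtain ⟨q, hq⟩ := h b hb
  refine ⟨p.reverse.append q, ?_⟩
  intro v hv
  rw [SimpleGraph.Walk.mem_support_append_iff] at hv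
  rcases hv with hv | hv
  · exact hp v (by simpa using hv)
  · exact hq v hv

theorem walk_prop_prefix {G : SimpleGraph V} {R : V → Prop} {x y : V} (p : G.Walk x y)
    (hp : ∀ v ∈ p.support, R v) (v : V) (hv : v ∈ p.support) :
    ∃ q : G.Walk x v, ∀ w ∈ q.support, R w := by
  classical
  exact ⟨p.takeUntil v hv, fun w hw => hp w (p.support_takeUntil_subset_support hv hw)⟩

theorem comp_sconn {G : SimpleGraph V} (A : Set V) (x : V) : SConn G (comp G A x) := by
  refine pathconn (x := x) ?_
  rintro y ⟨p, hp⟩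
  refine ⟨p, fun v hv => ?_⟩
  exact walk_prop_prefix p hp v hv

theorem comp_compl_aux {G : SimpleGraph V} {A : Set V} {x : V} {v a : V} (p : G.Walk v a) (ha : a ∈ A)
    (hv : v ∉ comp G A x) :
    ∃ a' ∈ A, ∃ q : G.Walk v a', ∀ w ∈ q.support, w ∉ comp G A x := by
  induction p with
  | nil => exact ⟨_, ha, SimpleGraph.Walk.nil, by simpa using hv⟩
  | @cons u v' w h p ih =>
    by_cases hu : u ∈ A
    · exact ⟨u, hu, SimpleGraph.Walk.nil, by simpa using hv⟩
    · have : v' ∉ comp G A x := fun hv' => hv (comp_adj hv' h.symm hu)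
      obtain ⟨a', ha', q, hq⟩ := ih ha this
      refine ⟨a', ha', SimpleGraph.Walk.cons h q, ?_⟩
      intro z hz
      rw [SimpleGraph.Walk.support_cons, List.mem_cons] at hz
      rcases hz with rfl | hz
      · exact hv
      · exact hq z hz

theorem comp_compl_sconn {G : SimpleGraph V} (hG : G.Connected) {A : Set V} (hA : SConn G A) (a : V)
    (ha : a ∈ A) (x : V) : SConn G (comp G A x)ᶜ := by
  refine pathconn (x := a) ?_
  intro y hy
  obtain ⟨p⟩ := hG.preconnected y a
  obtain ⟨a', ha', q, hq⟩ := comp_compl_aux p ha hy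
  obtain ⟨q', hq'⟩ := hA a ha a' ha'
  refine ⟨q'.append q.reverse, ?_⟩
  intro v hv
  rw [SimpleGraph.Walk.mem_support_append_iff] at hv
  rcases hv with hv | hv
  · exact fun h => comp_notMem h (hq' v hv)
  · exact hq v (by simpa using hv)

theorem inT_comp {G : SimpleGraph V} {A : Set V} {x b : V} (h : InT G (comp G A x) b) :
    b ∉ A ∧ ∃ a ∈ A, G.Adj a b := by
  obtain ⟨h1, a, h2, h3⟩ := h
  refine ⟨comp_notMem h1, a, ?_, h3⟩
  by_contra ha
  exact h2 (comp_adj h1 h3.symm ha)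

theorem exists_inT {G : SimpleGraph V} {Q : Set V} {x a : V} (p : G.Walk x a) (hx : x ∈ Q) (ha : a ∉ Q) :
    ∃ b, InT G Q b := by
  induction p with
  | nil => exact absurd hx ha
  | @cons u v w h p ih =>
    by_cases hv : v ∈ Q
    · exact ih hv ha
    · exact ⟨u, hx, v, hv, h.symm⟩

theorem far_point {G : SimpleGraph V} (hG : G.Connected) {du cu : ℝ} (hV : VolUpper G du cu)
    {S : Set V} (hS : S.Infinite) (b : V) (t : ℝ) : ∃ q ∈ S, t ≤ (G.dist b q : ℝ) := by
  by_contra hcon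
  push Not at hcon
  exact hS ((dist_fin hG hV b t).subset fun q hq => (hcon q hq).le)

theorem cluster_sconn (G : SimpleGraph V) (ω : V → Bool) (x : V) : SConn G (openCluster G ω x) := by
  refine pathconn (x := x) ?_
  rintro y ⟨hx, p, hp⟩
  exact ⟨p, fun v hv => ⟨hx, walk_prop_prefix p hp v hv⟩⟩

theorem cluster_adj {G : SimpleGraph V} {ω : V → Bool} {x y z : V} (h : y ∈ openCluster G ω x)
    (hyz : G.Adj y z) (hz : ω z = true) : z ∈ openCluster G ω x := by
  obtain ⟨hx, p, hp⟩ := h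
  refine ⟨hx, p.append (SimpleGraph.Walk.cons hyz SimpleGraph.Walk.nil), ?_⟩
  intro v hv
  rw [SimpleGraph.Walk.mem_support_append_iff] at hv
  rcases hv with hv | hv
  · exact hp v hv
  · simp at hv
    rcases hv with rfl | rfl
    · exact hp _ p.end_mem_support
    · exact hz

theorem cluster_trans {G : SimpleGraph V} {ω : V → Bool} {x y : V} (h : y ∈ openCluster G ω x) :
    openCluster G ω y = openCluster G ω x := by
  obtain ⟨hx, p, hp⟩ := h
  ext z
  constructor
  · rintro ⟨_, q, hq⟩
    refine ⟨hx, p.append q, fun v hv => ?_⟩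
    rw [SimpleGraph.Walk.mem_support_append_iff] at hv
    exact hv.elim (hp v) (hq v)
  · rintro ⟨_, q, hq⟩
    refine ⟨hp y p.end_mem_support, p.reverse.append q, fun v hv => ?_⟩
    rw [SimpleGraph.Walk.mem_support_append_iff] at hv
    exact hv.elim (fun h => hp v (by simpa using h)) (hq v)

theorem exists_comp {G : SimpleGraph V} {A : Set V} {x a : V} (p : G.Walk x a) (hx : x ∉ A) (ha : a ∈ A) :
    ∃ v, v ∉ A ∧ (∃ a ∈ A, G.Adj a v) ∧ x ∈ comp G A v := by
  induction p with
  | nil => exact absurd ha hx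
  | @cons u v w h p ih =>
    by_cases hv : v ∈ A
    · exact ⟨u, hx, ⟨v, hv, h.symm⟩, SimpleGraph.Walk.nil, by simpa using hx⟩
    · obtain ⟨z, h1, h2, h3⟩ := ih hv ha
      exact ⟨z, h1, h2, comp_adj h3 h.symm hx⟩

theorem unique_of_X {G : SimpleGraph V} (hG : G.Connected) {du cu : ℝ} (hV : VolUpper G du cu)
    [Infinite V] {ω : V → Bool} (o : V)
    (X : ∃ D0 : ℝ, ∀ (Q : Set V), SConn G Q → SConn G Qᶜ → (∀ b, InT G Q b → ω b = false) →
      ∀ (b0 : V) (D : ℝ), InT G Q b0 → D0 ≤ D → (G.dist o b0 : ℝ) ≤ 3 * D →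
      (∀ b, InT G Q b → (G.dist b0 b : ℝ) ≤ D →
        (∃ q ∈ Q, D ≤ G.dist b q) ∧ (∃ q, q ∉ Q ∧ D ≤ G.dist b q)) → False) :
    UniqueInfCluster G ω := by
  classical
  obtain ⟨D0, X⟩ := X
  constructor
  · by_contra hcon
    push Not at hcon
    obtain ⟨n, hn⟩ : ∃ n : ℕ, 2 * D0 ≤ n := exists_nat_ge _
    let F : Set V := {v | G.dist o v ≤ n} ∪ ⋃ w ∈ {w | (G.dist o w : ℝ) ≤ n + 1}, openCluster G ω w
    have hFfin : F.Finite := by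
      refine Set.Finite.union ?_ ?_
      · refine (dist_fin hG hV o n).subset fun v hv => ?_
        have hv' : G.dist o v ≤ n := hv
        show (G.dist o v : ℝ) ≤ n
        exact_mod_cast hv'
      · exact (dist_fin hG hV o (n + 1)).biUnion fun w _ => hcon w
    have hoF : o ∈ F := Or.inl (by simp)
    have walkF : ∀ {w : V} (p : G.Walk w o), p.length ≤ n → ∀ v ∈ p.support, v ∈ F := by
      intro w p hp v hv
      left
      have h1 := SimpleGraph.dist_le (p.dropUntil v hv)
      have h2 := p.length_dropUntil_le_length hv
      show G.dist o v ≤ n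
      rw [SimpleGraph.dist_comm]
      omega
    have hFconn : SConn G F := by
      refine pathconn (x := o) ?_
      have main : ∀ y ∈ F, ∃ p : G.Walk y o, ∀ v ∈ p.support, v ∈ F := by
        rintro y (hy | hy)
        · obtain ⟨p, hp⟩ := hG.exists_walk_length_eq_dist y o
          refine ⟨p, walkF p ?_⟩
          rw [hp, SimpleGraph.dist_comm]; exact hy
        · rw [Set.mem_iUnion₂] at hy
          obtain ⟨w, hw, hyw⟩ := hy
          have hcl : openCluster G ω w ⊆ F := by
            intro z hz
            right
            rw [Set.mem_iUnion₂]
            exact ⟨w, hw, hz⟩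
          have hww : w ∈ openCluster G ω w := ⟨hyw.1, SimpleGraph.Walk.nil, by simpa using hyw.1⟩
          obtain ⟨q, hq⟩ := cluster_sconn G ω w y hyw w hww
          obtain ⟨p, hp⟩ := hG.exists_walk_length_eq_dist w o
          have hwd : G.dist w o ≤ n + 1 := by
            rw [SimpleGraph.dist_comm]
            have hw' : (G.dist o w : ℝ) ≤ n + 1 := hw
            exact_mod_cast hw'
          refine ⟨q.append p, fun v hv => ?_⟩
          rw [SimpleGraph.Walk.mem_support_append_iff] at hv
          rcases hv with hv | hv
          · exact hcl (hq v hv)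
          · cases p with
            | nil =>
              simp at hv
              rw [hv]; exact hoF
            | cons h p =>
              rw [SimpleGraph.Walk.support_cons, List.mem_cons] at hv
              rcases hv with rfl | hv
              · exact hcl hww
              · refine walkF p ?_ v hv
                rw [SimpleGraph.Walk.length_cons] at hp
                omega
      intro y hy
      obtain ⟨p, hp⟩ := main y hy
      exact ⟨p.reverse, fun v hv => hp v (by simpa using hv)⟩
    -- infinite component
    let N : Set V := {v | v ∉ F ∧ ∃ a ∈ F, G.Adj a v}
    have hNfin : N.Finite := by
      refine (hFfin.biUnion fun a _ => ball_fin hV a 1).subset ?_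
      rintro v ⟨_, a, ha, hav⟩
      rw [Set.mem_iUnion₂]
      refine ⟨a, ha, ?_⟩
      rw [mem_gball_iff' hG, SimpleGraph.dist_eq_one_iff_adj.2 hav]; simp
    obtain ⟨v, hvN, hvinf⟩ : ∃ v ∈ N, (comp G F v).Infinite := by
      by_contra hno
      push Not at hno
      have h1 : (F ∪ ⋃ v ∈ N, comp G F v).Finite :=
        hFfin.union (hNfin.biUnion fun v hv => hno v hv)
      refine Set.infinite_univ (h1.subset ?_)
      intro x _
      by_cases hx : x ∈ F
      · exact Or.inl hx
      · right
        obtain ⟨p⟩ := hG.preconnected x o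
        obtain ⟨v, h1, h2, h3⟩ := exists_comp p hx hoF
        rw [Set.mem_iUnion₂]
        exact ⟨v, ⟨h1, h2⟩, h3⟩
    have hvT : InT G (comp G F v) v := by
      obtain ⟨h1, a, ha, hav⟩ := hvN
      exact ⟨⟨SimpleGraph.Walk.nil, by simpa using h1⟩, a, fun h => comp_notMem h ha, hav⟩
    have hvd : (n : ℝ) < G.dist o v := by
      have : n < G.dist o v := by
        by_contra hle
        exact hvN.1 (Or.inl (not_lt.1 hle))
      exact_mod_cast this
    refine X (comp G F v) (comp_sconn F v) (comp_compl_sconn hG hFconn o hoF v) ?_ v (G.dist o v / 2)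
      hvT (by linarith) (by linarith) ?_
    · intro b hb
      obtain ⟨h1, a, ha, hab⟩ := inT_comp hb
      by_contra hbo
      have hbo' : ω b = true := by simpa using hbo
      apply h1
      right
      rcases ha with ha | ha
      · rw [Set.mem_iUnion₂]
        refine ⟨b, ?_, hbo', SimpleGraph.Walk.nil, by simpa using hbo'⟩
        have e1 := adj_dist_le hG o hab
        have ha' : G.dist o a ≤ n := ha
        show (G.dist o b : ℝ) ≤ n + 1
        exact_mod_cast (by omega)
      · rw [Set.mem_iUnion₂] at ha ⊢
        obtain ⟨w, hw, haw⟩ := ha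
        exact ⟨w, hw, cluster_adj haw hab hbo'⟩
    · intro b hb hbd
      refine ⟨far_point hG hV hvinf b _, o, fun h => comp_notMem h hoF, ?_⟩
      have tri := rtri hG o b v
      rw [rsymm o b, rsymm b v] at tri
      linarith
  · intro x y hx hy
    by_contra hne
    have hyy : y ∈ openCluster G ω y := by
      obtain ⟨z, hz⟩ := hy.nonempty
      exact ⟨hz.1, SimpleGraph.Walk.nil, by simpa using hz.1⟩
    have hxx : x ∈ openCluster G ω x := by
      obtain ⟨z, hz⟩ := hx.nonempty
      exact ⟨hz.1, SimpleGraph.Walk.nil, by simpa using hz.1⟩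
    set A := openCluster G ω x with hA
    have hdisj : ∀ z ∈ openCluster G ω y, z ∉ A := by
      intro z hz hzA
      exact hne ((cluster_trans hzA).symm.trans (cluster_trans hz))
    have hsub : openCluster G ω y ⊆ comp G A y := by
      intro z hz
      obtain ⟨p, hp⟩ := cluster_sconn G ω y y hyy z hz
      exact ⟨p, fun v hv => hdisj v (hp v hv)⟩
    have hinf1 : (comp G A y).Infinite := hy.mono hsub
    have hinf2 : (comp G A y)ᶜ.Infinite := hx.mono fun z hz h => comp_notMem h hz
    obtain ⟨p⟩ := hG.preconnected y x
    obtain ⟨b0, hb0⟩ := exists_inT (Q := comp G A y) p (hsub hyy) (fun h => comp_notMem h hxx)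
    refine X (comp G A y) (comp_sconn A y) (comp_compl_sconn hG (cluster_sconn G ω x) x hxx y) ?_
      b0 (max D0 (G.dist o b0)) hb0 (le_max_left _ _) ?_ ?_
    · intro b hb
      obtain ⟨h1, a, ha, hab⟩ := inT_comp hb
      by_contra hbo
      exact h1 (cluster_adj ha hab (by simpa using hbo))
    · have e1 := le_max_right D0 (G.dist o b0 : ℝ)
      have e2 : (0:ℝ) ≤ G.dist o b0 := by positivity
      linarith
    · intro b hb _
      refine ⟨far_point hG hV hinf1 b _, ?_⟩
      obtain ⟨q, hq, hq'⟩ := far_point hG hV hinf2 b (max D0 (G.dist o b0))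
      exact ⟨q, hq, hq'⟩

end Topo


section Nets

theorem exists_net (G : SimpleGraph V) (ρ : ℝ) (hρ : 0 ≤ ρ) :
    ∃ f : V → V, (∀ y, (G.dist y (f y) : ℝ) ≤ ρ) ∧ ∀ y y', f y ≠ f y' → ρ < (G.dist (f y) (f y') : ℝ) := by
  obtain ⟨N, hN⟩ := zorn_subset {S : Set V | S.Pairwise fun a b => ρ < (G.dist a b : ℝ)} (by
    intro c hc hchain
    refine ⟨⋃₀ c, ?_, fun s hs => Set.subset_sUnion_of_mem hs⟩
    exact (Set.pairwise_sUnion hchain.directedOn).2 fun s hs => hc hs)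
  have hex : ∀ y, ∃ z ∈ N, (G.dist y z : ℝ) ≤ ρ := by
    intro y
    by_contra hcon
    push Not at hcon
    have hins : (insert y N) ∈ {S : Set V | S.Pairwise fun a b => ρ < (G.dist a b : ℝ)} := by
      refine Set.Pairwise.insert hN.1 ?_
      intro b hb _
      refine ⟨hcon b hb, ?_⟩
      rw [rsymm]; exact hcon b hb
    have hy : y ∈ N := hN.2 hins (Set.subset_insert y N) (Set.mem_insert y N)
    have := hcon y hy
    simp at this
    linarith
  choose f hf1 hf2 using hex
  exact ⟨f, hf2, fun y y' h => hN.1 (hf1 y) (hf1 y') h⟩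

structure Cells (G : SimpleGraph V) (r : ℕ → ℝ) (c : ℕ → V → V) : Prop where
  near : ∀ j y, (G.dist y (c j y) : ℝ) ≤ 2 * r j
  nest : ∀ m k, m ≤ k → ∃ h : V → V, ∀ y, c k y = h (c m y)
  sep : ∀ j y y', c j y ≠ c j y' → r j < (G.dist (c j y) (c j y') : ℝ)

def cellRec (f : ℕ → V → V) : ℕ → V → V
  | 0 => f 0
  | j + 1 => fun y => f (j + 1) (cellRec f j y)

theorem exists_cells {G : SimpleGraph V} (hG : G.Connected) {r : ℕ → ℝ} (hr : Scales r) :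
    ∃ c, Cells G r c := by
  choose f hf1 hf2 using fun j => exists_net G (r j) (by have := hr.three j; linarith)
  refine ⟨cellRec f, ?_, ?_, ?_⟩
  · intro j
    induction j with
    | zero => intro y; have := hf1 0 y; have := hr.three 0; simp only [cellRec]; linarith
    | succ j ih =>
      intro y
      have h1 := ih y
      have h2 := hf1 (j + 1) (cellRec f j y)
      have h3 := hr.grow j
      have h4 := hr.three j
      have h5 := rtri hG y (cellRec f j y) (f (j + 1) (cellRec f j y))
      simp only [cellRec]
      linarith
  · intro m k hmk
    induction k, hmk using Nat.le_induction with
    | base => exact ⟨id, fun y => rfl⟩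
    | succ k hk ih =>
      obtain ⟨h, hh⟩ := ih
      exact ⟨fun z => f (k + 1) (h z), fun y => by simp only [cellRec]; rw [hh]⟩
  · intro j y y' hne
    cases j with
    | zero => exact hf2 0 _ _ hne
    | succ j => exact hf2 (j + 1) _ _ hne

open scoped Classical in
theorem cells_count {G : SimpleGraph V} (hG : G.Connected) {r : ℕ → ℝ} (hr : Scales r)
    {c : ℕ → V → V} (hc : Cells G r c) {du cu dl cl : ℝ} (hcu : 0 < cu) (hcl : 0 < cl)
    (hV : VolUpper G du cu) (hL : VolLower G dl cl) (x : V) (R : ℝ) (j : ℕ) (hR : r j ≤ R)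
    (S : Finset V) (hS : ∀ y ∈ S, (G.dist x y : ℝ) ≤ R) :
    ((S.image (c j)).card : ℝ) ≤ cu * 4 ^ du * 3 ^ dl / cl * R ^ du * r j ^ (-dl) := by
  have hr3 := hr.three j
  set I := S.image (c j) with hI
  set B : V → Finset V := fun z => (ball_fin hV z (r j / 3)).toFinset with hB
  have memB : ∀ z y, y ∈ B z ↔ (G.dist z y : ℝ) ≤ r j / 3 := by
    intro z y
    simp [hB, mem_gball_iff' hG]
  have hBc : ∀ z, cl * (r j / 3) ^ dl ≤ ((B z).card : ℝ) := by
    intro z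
    have := hL z (r j / 3) (by linarith)
    rwa [Set.ncard_eq_toFinset_card _ (ball_fin hV z (r j / 3))] at this
  have hdis : (I : Set V).PairwiseDisjoint B := by
    intro a ha b hb hab
    rw [Finset.mem_coe, hI, Finset.mem_image] at ha hb
    obtain ⟨y, _, rfl⟩ := ha
    obtain ⟨y', _, rfl⟩ := hb
    have h1 := hc.sep j y y' hab
    refine Finset.disjoint_left.2 fun z hz hz' => ?_
    rw [memB] at hz hz'
    have h2 := rtri hG (c j y) z (c j y')
    rw [rsymm z (c j y')] at h2
    linarith
  have hsub : I.biUnion B ⊆ (ball_fin hV x (4 * R)).toFinset := by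
    intro z hz
    rw [Finset.mem_biUnion] at hz
    obtain ⟨a, ha, hz⟩ := hz
    rw [hI, Finset.mem_image] at ha
    obtain ⟨y, hy, rfl⟩ := ha
    rw [memB] at hz
    rw [Set.Finite.mem_toFinset, mem_gball_iff' hG]
    have h1 := hS y hy
    have h2 := hc.near j y
    have h3 := rtri hG x y z
    have h4 := rtri hG y (c j y) z
    linarith
  have h1 := Finset.card_le_card hsub
  rw [Finset.card_biUnion hdis, ← Set.ncard_eq_toFinset_card _ (ball_fin hV x (4 * R))] at h1
  have h2 := (hV x (4 * R) (by linarith)).2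
  have h3 : (I.card : ℝ) * (cl * (r j / 3) ^ dl) ≤ cu * (4 * R) ^ du := by
    have e1 : ∑ z ∈ I, (cl * (r j / 3) ^ dl) ≤ ∑ z ∈ I, ((B z).card : ℝ) :=
      Finset.sum_le_sum fun z _ => hBc z
    rw [Finset.sum_const, nsmul_eq_mul] at e1
    have e2 : ∑ z ∈ I, ((B z).card : ℝ) ≤ ((gball G x (4 * R)).ncard : ℝ) := by exact_mod_cast h1
    linarith
  have hpos : 0 < cl * (r j / 3) ^ dl := by
    have : 0 < r j / 3 := by linarith
    positivity
  rw [← le_div_iff₀ hpos] at h3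
  refine h3.trans (le_of_eq ?_)
  rw [Real.mul_rpow (by norm_num) (by linarith), Real.div_rpow (by linarith) (by norm_num),
    Real.rpow_neg (by linarith)]
  have : 0 < r j ^ dl := Real.rpow_pos_of_pos (by linarith) _
  have : (0:ℝ) < 3 ^ dl := by positivity
  field_simp

end Nets

section Meas

theorem meas_of_det (S S0 : Set V) (hS : S.Finite) (hSS : S ⊆ S0) (E : Set (V → Bool))
    (hE : ∀ ω ω' : V → Bool, (∀ z ∈ S, ω z = ω' z) → (ω ∈ E ↔ ω' ∈ E)) :
    MeasurableSet[cylσ S0] E := by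
  classical
  have : Finite S := hS
  let ext : (S → Bool) → (V → Bool) := fun g v => if h : v ∈ S then g ⟨v, h⟩ else false
  let res : (V → Bool) → (S → Bool) := fun ω z => ω z
  have hEeq : E = res ⁻¹' {g | ext g ∈ E} := by
    ext ω
    show ω ∈ E ↔ ext (res ω) ∈ E
    refine hE _ _ fun z hz => ?_
    simp [ext, res, hz]
  have hres : @Measurable _ _ (cylσ S0) MeasurableSpace.pi res := by
    rw [@measurable_pi_iff]
    intro z
    have h1 : @Measurable _ _ (cylσ S0) MeasurableSpace.pi (fun ω : V → Bool => S0.restrict ω) :=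
      comap_measurable _
    have h2 : Measurable (fun g : S0 → Bool => g ⟨z, hSS z.2⟩) := measurable_pi_apply _
    exact h2.comp h1
  rw [hEeq]
  exact hres (Set.toFinite _).measurableSet

theorem dec_real {G : SimpleGraph V} {P : Measure (V → Bool)} [IsProbabilityMeasure P] {α cα : ℝ}
    (hcα : 0 < cα) (hD : Decoupling G P α cα) (x : V) (ρ : ℝ) (hρ : 1 ≤ ρ) (E E' : Set (V → Bool))
    (h1 : DecreasingEvent E) (h2 : DecreasingEvent E')
    (h3 : MeasurableSet[cylσ (gball G x ρ)] E) (h4 : MeasurableSet[cylσ (gball G x (2 * ρ))ᶜ] E') :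
    P.real (E ∩ E') ≤ P.real E * P.real E' + cα * ρ ^ (-α) := by
  have h := hD x ρ hρ E E' h1 h2 h3 h4
  have hpos : 0 ≤ cα * ρ ^ (-α) := by
    have : 0 ≤ ρ := by linarith
    positivity
  have hfin : P E * P E' + ENNReal.ofReal (cα * ρ ^ (-α)) ≠ ⊤ :=
    ENNReal.add_ne_top.2 ⟨ENNReal.mul_ne_top (measure_ne_top _ _) (measure_ne_top _ _), ENNReal.ofReal_ne_top⟩
  have h' := ENNReal.toReal_mono hfin h
  rw [ENNReal.toReal_add (ENNReal.mul_ne_top (measure_ne_top _ _) (measure_ne_top _ _)) ENNReal.ofReal_ne_top,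
    ENNReal.toReal_mul, ENNReal.toReal_ofReal hpos] at h'
  exact h'

end Meas


section Prob

open scoped Classical in
noncomputable def Ecell (P : Measure (V → Bool)) (Z : V → Set (V → Bool)) (c : V → V) (S : Finset V) : ℝ :=
  ∑ a ∈ S.image c, P.real {ω | ∃ y ∈ S, ω ∈ Z y ∧ c y = a}

theorem Ecell_nonneg (P : Measure (V → Bool)) (Z : V → Set (V → Bool)) (c : V → V) (S : Finset V) :
    0 ≤ Ecell P Z c S := Finset.sum_nonneg fun _ _ => measureReal_nonneg

theorem Ecell_coarse (P : Measure (V → Bool)) [IsProbabilityMeasure P] (Z : V → Set (V → Bool))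
    (c h : V → V) (S : Finset V) : Ecell P Z (fun y => h (c y)) S ≤ Ecell P Z c S := by
  classical
  unfold Ecell
  have hmaps : ∀ b ∈ S.image c, h b ∈ S.image (fun y => h (c y)) := by
    intro b hb
    rw [Finset.mem_image] at hb ⊢
    obtain ⟨y, hy, rfl⟩ := hb
    exact ⟨y, hy, rfl⟩
  rw [← Finset.sum_fiberwise_of_maps_to hmaps]
  refine Finset.sum_le_sum fun a _ => ?_
  refine (measureReal_mono (h₂ := measure_ne_top _ _) (?_ : _ ⊆ ⋃ b ∈ (S.image c).filter (fun b => h b = a),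
    {ω | ∃ y ∈ S, ω ∈ Z y ∧ c y = b})).trans (measureReal_biUnion_finset_le _ _)
  rintro ω ⟨y, hy, hyZ, hya⟩
  rw [Set.mem_iUnion₂]
  refine ⟨c y, ?_, y, hy, hyZ, rfl⟩
  rw [Finset.mem_filter]
  exact ⟨Finset.mem_image_of_mem _ hy, hya⟩

theorem Ecell_union (P : Measure (V → Bool)) [IsProbabilityMeasure P] (Z : V → Set (V → Bool))
    (c : V → V) (S : Finset V) : P.real {ω | ∃ y ∈ S, ω ∈ Z y} ≤ Ecell P Z c S := by
  classical
  unfold Ecell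
  refine (measureReal_mono (h₂ := measure_ne_top _ _) (?_ : _ ⊆ ⋃ b ∈ S.image c,
    {ω | ∃ y ∈ S, ω ∈ Z y ∧ c y = b})).trans (measureReal_biUnion_finset_le _ _)
  rintro ω ⟨y, hy, hyZ⟩
  rw [Set.mem_iUnion₂]
  exact ⟨c y, Finset.mem_image_of_mem _ hy, y, hy, hyZ, rfl⟩

theorem Ecell_id (P : Measure (V → Bool)) [IsProbabilityMeasure P] (Z : V → Set (V → Bool))
    (c : V → V) (S : Finset V) : Ecell P Z c S ≤ ∑ y ∈ S, P.real (Z y) := by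
  classical
  have h1 := Ecell_coarse P Z id c S
  refine h1.trans ?_
  unfold Ecell
  rw [Finset.image_id]
  refine Finset.sum_le_sum fun a _ => measureReal_mono (?_) (measure_ne_top _ _)
  rintro ω ⟨y, _, hy, rfl⟩
  exact hy

/-- many well separated bad points -/
def Aset (G : SimpleGraph V) (r : ℕ → ℝ) (M J m k : ℕ) (S : Finset V) (j : ℕ) : Set (V → Bool) :=
  {ω | ∃ F : Finset V, F ⊆ S ∧ F.card = j ∧ (∀ f ∈ F, NB G r M J ω m f) ∧
    (∀ f ∈ F, ∀ g ∈ F, f ≠ g → r (k - 1) < (G.dist f g : ℝ))}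

def Wset (G : SimpleGraph V) (r : ℕ → ℝ) (M J m k : ℕ) (S : Finset V) (j : ℕ) (c : V) : Set (V → Bool) :=
  {ω | ∃ F : Finset V, F ⊆ S ∧ F.card = j ∧ (∀ f ∈ F, NB G r M J ω m f) ∧
    (∀ f ∈ F, ∀ g ∈ F, f ≠ g → r (k - 1) < (G.dist f g : ℝ)) ∧
    (∀ f ∈ F, r (k - 1) - 2 * r (k - 2) < (G.dist c f : ℝ))}

def Zset (G : SimpleGraph V) (r : ℕ → ℝ) (M J m : ℕ) (y : V) : Set (V → Bool) :=
  {ω | NB G r M J ω m y}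

theorem W_sub_A (G : SimpleGraph V) (r : ℕ → ℝ) (M J m k : ℕ) (S : Finset V) (j : ℕ) (c : V) :
    Wset G r M J m k S j c ⊆ Aset G r M J m k S j := by
  rintro ω ⟨F, h1, h2, h3, h4, _⟩
  exact ⟨F, h1, h2, h3, h4⟩

theorem dec_cell {G : SimpleGraph V} (hG : G.Connected) {du cu : ℝ} (hV : VolUpper G du cu)
    {r : ℕ → ℝ} (hr : Scales r) {M J : ℕ} {P : Measure (V → Bool)} [IsProbabilityMeasure P] {α cα : ℝ}
    (hcα : 0 < cα) (hD : Decoupling G P α cα) {c : ℕ → V → V} (hc : Cells G r c)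
    (m k : ℕ) (hmk : m + 2 ≤ k) (S S' : Finset V) (j : ℕ) (a : V) :
    P.real ({ω | ∃ y ∈ S, ω ∈ Zset G r M J m y ∧ c (k - 2) y = a} ∩ Wset G r M J m k S' j a) ≤
      P.real {ω | ∃ y ∈ S, ω ∈ Zset G r M J m y ∧ c (k - 2) y = a} * P.real (Wset G r M J m k S' j a)
        + cα * (6 * r (k - 2)) ^ (-α) := by
  have hX := hr.three (k - 2)
  have hmX : r m ≤ r (k - 2) := hr.mono (by omega)
  have hXX := hr.lt_grow (show k - 2 < k - 1 by omega)
  have hdecNB : ∀ (ω ω' : V → Bool) (y : V), (∀ x, (G.dist y x : ℝ) ≤ 4 * r m → ω' x ≤ ω x) →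
      NB G r M J ω m y → NB G r M J ω' m y := fun ω ω' y h hNB => hNB.mono_local hG hr h
  refine dec_real hcα hD a (6 * r (k - 2)) (by linarith) _ _ ?_ ?_ ?_ ?_
  · rintro ω ⟨y, hy, hyZ, hya⟩ ω' hle
    exact ⟨y, hy, hdecNB ω ω' y (fun x _ => hle x) hyZ, hya⟩
  · rintro ω ⟨F, h1, h2, h3, h4, h5⟩ ω' hle
    exact ⟨F, h1, h2, fun f hf => hdecNB ω ω' f (fun x _ => hle x) (h3 f hf), h4, h5⟩
  · refine meas_of_det (gball G a (6 * r (k - 2))) _ (ball_fin hV _ _) subset_rfl _ ?_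
    have key : ∀ ω ω' : V → Bool, (∀ z ∈ gball G a (6 * r (k - 2)), ω z = ω' z) →
        (∃ y ∈ S, ω ∈ Zset G r M J m y ∧ c (k - 2) y = a) →
        ∃ y ∈ S, ω' ∈ Zset G r M J m y ∧ c (k - 2) y = a := by
      rintro ω ω' hz ⟨y, hy, hyZ, hya⟩
      refine ⟨y, hy, hdecNB ω ω' y (fun x hx => ?_) hyZ, hya⟩
      refine (hz x ?_).ge
      rw [mem_gball_iff' hG]
      have h1 := hc.near (k - 2) y
      rw [hya] at h1
      have h2 := rtri hG a y x
      rw [rsymm a y] at h2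
      linarith
    exact fun ω ω' hz => ⟨key ω ω' hz, key ω' ω fun z h => (hz z h).symm⟩
  · set D : Set V := {z | z ∈ (gball G a (2 * (6 * r (k - 2))))ᶜ ∧ ∃ f ∈ S', (G.dist f z : ℝ) ≤ 4 * r m}
      with hDdef
    have hDfin : D.Finite := by
      refine (S'.finite_toSet.biUnion fun f _ => dist_fin hG hV f (4 * r m)).subset ?_
      rintro z ⟨_, f, hf, hz⟩
      rw [Set.mem_iUnion₂]
      exact ⟨f, hf, hz⟩
    refine meas_of_det D _ hDfin (fun z hz => hz.1) _ ?_
    have key : ∀ ω ω' : V → Bool, (∀ z ∈ D, ω z = ω' z) →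
        ω ∈ Wset G r M J m k S' j a → ω' ∈ Wset G r M J m k S' j a := by
      rintro ω ω' hz ⟨F, h1, h2, h3, h4, h5⟩
      refine ⟨F, h1, h2, fun f hf => hdecNB ω ω' f (fun x hx => ?_) (h3 f hf), h4, h5⟩
      refine (hz x ⟨?_, f, h1 hf, hx⟩).ge
      intro hxg
      rw [mem_gball_iff' hG] at hxg
      have e1 := h5 f hf
      have e2 := rtri hG a x f
      rw [rsymm x f] at e2
      linarith
    exact fun ω ω' hz => ⟨key ω ω' hz, key ω' ω fun z h => (hz z h).symm⟩

open scoped Classical in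
theorem dec_sum {G : SimpleGraph V} (hG : G.Connected) {du cu : ℝ} (hV : VolUpper G du cu)
    {r : ℕ → ℝ} (hr : Scales r) {M J : ℕ} {P : Measure (V → Bool)} [IsProbabilityMeasure P] {α cα : ℝ}
    (hcα : 0 < cα) (hD : Decoupling G P α cα) {c : ℕ → V → V} (hc : Cells G r c)
    (m k : ℕ) (hmk : m + 2 ≤ k) (S : Finset V) (S' : V → Finset V) (j : ℕ) (w : ℝ)
    (hw : ∀ a, P.real (Wset G r M J m k (S' a) j a) ≤ w) :
    ∑ a ∈ S.image (c (k - 2)), P.real ({ω | ∃ y ∈ S, ω ∈ Zset G r M J m y ∧ c (k - 2) y = a} ∩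
      Wset G r M J m k (S' a) j a) ≤ Ecell P (Zset G r M J m) (c m) S * w +
        (S.image (c (k - 2))).card * (cα * (6 * r (k - 2)) ^ (-α)) := by
  by_cases hw0 : 0 ≤ w
  · have h1 : ∑ a ∈ S.image (c (k - 2)), P.real ({ω | ∃ y ∈ S, ω ∈ Zset G r M J m y ∧ c (k - 2) y = a} ∩
        Wset G r M J m k (S' a) j a) ≤ ∑ a ∈ S.image (c (k - 2)),
        (P.real {ω | ∃ y ∈ S, ω ∈ Zset G r M J m y ∧ c (k - 2) y = a} * w
          + cα * (6 * r (k - 2)) ^ (-α)) := by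
      refine Finset.sum_le_sum fun a _ => (dec_cell hG hV hr hcα hD hc m k hmk S (S' a) j a).trans ?_
      have := mul_le_mul_of_nonneg_left (hw a)
        (measureReal_nonneg (μ := P) (s := {ω | ∃ y ∈ S, ω ∈ Zset G r M J m y ∧ c (k - 2) y = a}))
      linarith
    rw [Finset.sum_add_distrib, ← Finset.sum_mul, Finset.sum_const, nsmul_eq_mul] at h1
    refine h1.trans ?_
    obtain ⟨h, hh⟩ := hc.nest m (k - 2) (by omega)
    have h2 := Ecell_coarse P (Zset G r M J m) (c m) h S
    have h3 : (fun y => h (c m y)) = c (k - 2) := funext fun y => (hh y).symm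
    rw [h3] at h2
    have h4 := mul_le_mul_of_nonneg_right h2 hw0
    unfold Ecell at h4 ⊢
    linarith
  · by_cases hne : (S.image (c (k - 2))).Nonempty
    · obtain ⟨a, _⟩ := hne
      exact absurd (measureReal_nonneg.trans (hw a)) hw0
    · rw [Finset.not_nonempty_iff_eq_empty] at hne
      have hS : S = ∅ := by simpa using hne
      subst hS
      simp [Ecell]

theorem A_bound {G : SimpleGraph V} (hG : G.Connected) {du cu : ℝ} (hV : VolUpper G du cu)
    {r : ℕ → ℝ} (hr : Scales r) {M J : ℕ} {P : Measure (V → Bool)} [IsProbabilityMeasure P] {α cα : ℝ}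
    (hcα : 0 < cα) (hD : Decoupling G P α cα) {c : ℕ → V → V} (hc : Cells G r c)
    (m k : ℕ) (hmk : m + 2 ≤ k) (S : Finset V) (e n : ℝ) (he : Ecell P (Zset G r M J m) (c m) S ≤ e)
    (he2 : e ≤ 1 / 2) (hn : ∀ [DecidableEq V], ((S.image (c (k - 2))).card : ℝ) ≤ n) (j : ℕ) :
    P.real (Aset G r M J m k S j) ≤ e ^ j + 2 * n * (cα * (6 * r (k - 2)) ^ (-α)) := by
  classical
  have he0 : 0 ≤ e := (Ecell_nonneg _ _ _ _).trans he
  have hn0 : 0 ≤ n := le_trans (by positivity) hn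
  have herr : 0 ≤ cα * (6 * r (k - 2)) ^ (-α) := by
    have : 0 ≤ 6 * r (k - 2) := by have := hr.three (k - 2); linarith
    positivity
  set err := cα * (6 * r (k - 2)) ^ (-α) with herrdef
  induction j with
  | zero =>
    have : P.real (Aset G r M J m k S 0) ≤ 1 := measureReal_le_one
    have h2 : 0 ≤ 2 * n * err := by positivity
    simp only [pow_zero]
    linarith
  | succ j ih =>
    have hsub : Aset G r M J m k S (j + 1) ⊆ ⋃ a ∈ S.image (c (k - 2)),
        ({ω | ∃ y ∈ S, ω ∈ Zset G r M J m y ∧ c (k - 2) y = a} ∩ Wset G r M J m k S j a) := by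
      rintro ω ⟨F, h1, h2, h3, h4⟩
      obtain ⟨y, hy⟩ : F.Nonempty := Finset.card_pos.1 (by omega)
      rw [Set.mem_iUnion₂]
      refine ⟨c (k - 2) y, Finset.mem_image_of_mem _ (h1 hy), ⟨y, h1 hy, h3 y hy, rfl⟩, F.erase y,
        (Finset.erase_subset _ _).trans h1, by rw [Finset.card_erase_of_mem hy]; omega,
        fun f hf => h3 f (Finset.mem_of_mem_erase hf),
        fun f hf g hg => h4 f (Finset.mem_of_mem_erase hf) g (Finset.mem_of_mem_erase hg), ?_⟩
      intro f hf
      rw [Finset.mem_erase] at hf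
      have e1 := h4 y hy f hf.2 (Ne.symm hf.1)
      have e2 := hc.near (k - 2) y
      have e3 := rtri hG y (c (k - 2) y) f
      linarith
    have h1 := (measureReal_mono hsub (measure_ne_top P _)).trans (measureReal_biUnion_finset_le _ _)
    have h2 := dec_sum hG hV hr hcα hD hc m k hmk S (fun _ => S) j
      (P.real (Aset G r M J m k S j)) (M := M) (J := J)
      (fun a => measureReal_mono (W_sub_A G r M J m k S j a) (measure_ne_top _ _))
    have hAnn : 0 ≤ P.real (Aset G r M J m k S j) := measureReal_nonneg
    have h3 : P.real (Aset G r M J m k S (j + 1)) ≤ e * P.real (Aset G r M J m k S j) + n * err := by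
      refine (h1.trans h2).trans ?_
      have e1 := mul_le_mul_of_nonneg_right he hAnn
      have e2 : ((S.image (c (k - 2))).card : ℝ) * err ≤ n * err := mul_le_mul_of_nonneg_right hn herr
      linarith
    have h4 := mul_le_mul_of_nonneg_left ih he0
    have h5 : e * (2 * n * err) ≤ 1 / 2 * (2 * n * err) := mul_le_mul_of_nonneg_right he2 (by positivity)
    rw [pow_succ]
    nlinarith

end Prob


section Step

structure ProbCond (r : ℕ → ℝ) (M J : ℕ) (du C1 dl cα α a : ℝ) : Prop where
  q1 : ∀ m k, m + 2 ≤ k → k ≤ m + M → (3 * r k) ^ du * r m ^ (-a) ≤ 1 / 2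
  q2 : ∀ m k, m + 2 ≤ k → k ≤ m + M →
    M * (r m ^ (-a) * (((3 * r k) ^ du * r m ^ (-a)) ^ J +
      2 * (C1 * (3 * r k) ^ du * r (k - 2) ^ (-dl)) * (cα * (6 * r (k - 2)) ^ (-α))) +
      C1 * r (k - 2) ^ (-dl) * (cα * (6 * r (k - 2)) ^ (-α))) ≤ r k ^ (-a)

theorem main_induction {G : SimpleGraph V} (hG : G.Connected) {du cu dl cl : ℝ}
    (hcu : 0 < cu) (hcl : 0 < cl) (hV : VolUpper G du cu) (hL : VolLower G dl cl)
    {r : ℕ → ℝ} (hr : Scales r) {M J : ℕ} {P : Measure (V → Bool)} [IsProbabilityMeasure P] {α cα a : ℝ}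
    (hcα : 0 < cα) (hD : Decoupling G P α cα) {c : ℕ → V → V} (hc : Cells G r c)
    (hP : ProbCond r M J du (cu * 4 ^ du * 3 ^ dl / cl) dl cα α a)
    (hbase : ∀ y, P.real {ω | ω y = false} ≤ r 0 ^ (-a) / cu) :
    ∀ (k : ℕ) (x : V) (R : ℝ) (S : Finset V), r k ≤ R → (∀ y ∈ S, (G.dist x y : ℝ) ≤ R) →
      Ecell P (Zset G r M J k) (c k) S ≤ R ^ du * r k ^ (-a) := by
  classical
  intro k
  induction k using Nat.strong_induction_on with
  | _ k IH =>
  intro x R S hR hS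
  have hk3 := hr.three k
  have hR0 : 0 < R := by linarith
  by_cases hk0 : k = 0
  · subst hk0
    refine (Ecell_id P _ _ S).trans ?_
    have h1 : ∑ y ∈ S, P.real (Zset G r M J 0 y) ≤ ∑ y ∈ S, r 0 ^ (-a) / cu := by
      refine Finset.sum_le_sum fun y _ => ?_
      have : Zset G r M J 0 y = {ω | ω y = false} := by
        ext ω; exact NB.zero_iff
      rw [this]; exact hbase y
    rw [Finset.sum_const, nsmul_eq_mul] at h1
    have h2 : (S.card : ℝ) ≤ cu * R ^ du := by
      have e1 := (hV x R (by linarith)).2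
      have e2 : S.card ≤ (gball G x R).ncard := by
        rw [← Set.ncard_coe_finset]
        refine Set.ncard_le_ncard ?_ (ball_fin hV x R)
        intro y hy
        rw [mem_gball_iff' hG]
        exact hS y hy
      have e3 : (S.card : ℝ) ≤ (gball G x R).ncard := by exact_mod_cast e2
      linarith
    have hpos : 0 ≤ r 0 ^ (-a) / cu := by
      have : 0 ≤ r 0 := by linarith
      positivity
    have h3 := mul_le_mul_of_nonneg_right h2 hpos
    calc _ ≤ _ := h1
      _ ≤ _ := h3
      _ = _ := by field_simp
  by_cases hk1 : k = 1
  · subst hk1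
    have : Ecell P (Zset G r M J 1) (c 1) S = 0 := by
      unfold Ecell
      refine Finset.sum_eq_zero fun b _ => ?_
      have : {ω | ∃ y ∈ S, ω ∈ Zset G r M J 1 y ∧ c 1 y = b} = ∅ := by
        ext ω
        simp only [Set.mem_empty_iff_false, iff_false]
        rintro ⟨y, _, hy, _⟩
        exact NB.not_one hy
      rw [this]; simp
    rw [this]
    have : 0 ≤ r 1 := by linarith
    positivity
  have hk2 : 2 ≤ k := by omega
  set X := r (k - 2) with hX
  have hX3 : 3 ≤ X := hr.three _
  have hXk : 24 * X ≤ r k := hr.lt_grow (by omega)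
  set err := cα * (6 * X) ^ (-α) with herr
  have herr0 : 0 ≤ err := by
    have : 0 ≤ 6 * X := by linarith
    positivity
  set C1 := cu * 4 ^ du * 3 ^ dl / cl with hC1
  have hC10 : 0 ≤ C1 := by positivity
  set ms := (Finset.range (k - 1)).filter (fun m => k ≤ m + M) with hms
  have hmem : ∀ m, m ∈ ms ↔ (m + 2 ≤ k ∧ k ≤ m + M) := by
    intro m
    rw [hms, Finset.mem_filter, Finset.mem_range]
    constructor <;> rintro ⟨h1, h2⟩ <;> exact ⟨by omega, h2⟩
  have hmscard : ms.card ≤ M := by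
    have : ms ⊆ Finset.Ico (k - M) k := by
      intro m hm
      rw [hmem] at hm
      rw [Finset.mem_Ico]; omega
    have := Finset.card_le_card this
    rw [Nat.card_Ico] at this
    omega
  let S' : V → Finset V := fun b => (dist_fin hG hV b (3 * r k)).toFinset
  have hS' : ∀ b y, y ∈ S' b ↔ (G.dist b y : ℝ) ≤ 3 * r k := by
    intro b y; simp [S']
  -- coarsen
  obtain ⟨h, hh⟩ := hc.nest (k - 2) k (by omega)
  have h1 := Ecell_coarse P (Zset G r M J k) (c (k - 2)) h S
  have h1' : (fun y => h (c (k - 2) y)) = c k := funext fun y => (hh y).symm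
  rw [h1'] at h1
  refine h1.trans ?_
  have hsub : ∀ b, {ω | ∃ y ∈ S, ω ∈ Zset G r M J k y ∧ c (k - 2) y = b} ⊆
      ⋃ m ∈ ms, ({ω | ∃ y ∈ S, ω ∈ Zset G r M J m y ∧ c (k - 2) y = b} ∩
        Wset G r M J m k (S' b) J b) := by
    rintro b ω ⟨y, hy, hyZ, hyb⟩
    have hyZ' : NB G r M J ω k y := hyZ
    cases hyZ' with
    | base _ => omega
    | step m _ _ F g1 g2 g3 g4 g5 g6 g7 g8 =>
      rw [Set.mem_iUnion₂]
      refine ⟨m, (hmem m).2 ⟨g1, g2⟩, ⟨y, hy, g3, hyb⟩, F, ?_, g5, g4, g8, ?_⟩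
      · intro f hf
        rw [hS']
        have e1 := g6 f hf
        have e2 := hc.near (k - 2) y
        have e3 := rtri hG b y f
        rw [hyb, rsymm] at e2
        linarith
      · intro f hf
        have e1 := g7 f hf
        have e2 := hc.near (k - 2) y
        have e3 := rtri hG y b f
        rw [hyb] at e2
        linarith
  have h2 : Ecell P (Zset G r M J k) (c (k - 2)) S ≤ ∑ m ∈ ms, ∑ b ∈ S.image (c (k - 2)),
      P.real ({ω | ∃ y ∈ S, ω ∈ Zset G r M J m y ∧ c (k - 2) y = b} ∩
        Wset G r M J m k (S' b) J b) := by
    rw [Finset.sum_comm]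
    unfold Ecell
    refine Finset.sum_le_sum fun b _ => ?_
    exact (measureReal_mono (hsub b) (measure_ne_top P _)).trans (measureReal_biUnion_finset_le _ _)
  refine h2.trans ?_
  have hXR : X ≤ R := by linarith
  have hcount : ((S.image (c (k - 2))).card : ℝ) ≤ C1 * R ^ du * X ^ (-dl) := by
    have := cells_count hG hr hc hcu hcl hV hL x R (k - 2) hXR S hS
    exact this
  have hterm : ∀ m ∈ ms, M * (∑ b ∈ S.image (c (k - 2)),
      P.real ({ω | ∃ y ∈ S, ω ∈ Zset G r M J m y ∧ c (k - 2) y = b} ∩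
        Wset G r M J m k (S' b) J b)) ≤ R ^ du * r k ^ (-a) := by
    intro m hm
    rw [hmem] at hm
    have hmk : r m ≤ r k := hr.mono (by omega)
    have hm3 := hr.three m
    have hq1 := hP.q1 m k hm.1 hm.2
    have hq2 := hP.q2 m k hm.1 hm.2
    rw [← hX, ← herr] at hq2
    set e := (3 * r k) ^ du * r m ^ (-a) with he
    set n := C1 * (3 * r k) ^ du * X ^ (-dl) with hn
    have hW : ∀ b, P.real (Wset G r M J m k (S' b) J b) ≤ e ^ J + 2 * n * err := by
      intro b
      refine (measureReal_mono (W_sub_A G r M J m k (S' b) J b) (measure_ne_top _ _)).trans ?_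
      refine A_bound hG hV hr hcα hD hc m k hm.1 (S' b) e n ?_ hq1 ?_ J
      · exact IH m (by omega) b (3 * r k) (S' b) (by linarith) fun y hy => (hS' b y).1 hy
      · intro inst
        have := cells_count hG hr hc hcu hcl hV hL b (3 * r k) (k - 2) (by linarith) (S' b)
          fun y hy => (hS' b y).1 hy
        convert this
    have h3 := dec_sum hG hV hr hcα hD hc m k hm.1 S S' J (e ^ J + 2 * n * err) (M := M) (J := J) hW
    have h4 := IH m (by omega) x R S (by linarith) hS
    have hm0 : 0 ≤ r m := by linarith
    have hk0' : 0 ≤ 3 * r k := by linarith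
    have hX0 : 0 ≤ X := by linarith
    have he0 : 0 ≤ e := by positivity
    have hn0 : 0 ≤ n := by positivity
    have hw0 : 0 ≤ e ^ J + 2 * n * err := by positivity
    have h5 := mul_le_mul_of_nonneg_right h4 hw0
    have h6 := mul_le_mul_of_nonneg_right hcount herr0
    have hM0 : (0:ℝ) ≤ M := by positivity
    have hRdu : 0 ≤ R ^ du := by positivity
    calc _ ≤ (M:ℝ) * (R ^ du * r m ^ (-a) * (e ^ J + 2 * n * err) + C1 * R ^ du * X ^ (-dl) * err) := by
          refine mul_le_mul_of_nonneg_left ?_ hM0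
          rw [← hX, ← herr] at h3
          linarith
      _ = R ^ du * (M * (r m ^ (-a) * (e ^ J + 2 * n * err) + C1 * X ^ (-dl) * err)) := by ring
      _ ≤ _ := mul_le_mul_of_nonneg_left hq2 hRdu
  have hfin : 0 ≤ R ^ du * r k ^ (-a) := by
    have : 0 ≤ r k := by linarith
    positivity
  by_cases hM : M = 0
  · have : ms = ∅ := by
      rw [← Finset.card_eq_zero]; omega
    rw [this, Finset.sum_empty]; exact hfin
  have hM0 : (0:ℝ) < M := by exact_mod_cast Nat.pos_of_ne_zero hM
  have h7 : ∑ m ∈ ms, ∑ b ∈ S.image (c (k - 2)),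
      P.real ({ω | ∃ y ∈ S, ω ∈ Zset G r M J m y ∧ c (k - 2) y = b} ∩
        Wset G r M J m k (S' b) J b) ≤ ∑ m ∈ ms, (R ^ du * r k ^ (-a)) / M := by
    refine Finset.sum_le_sum fun m hm => ?_
    rw [le_div_iff₀ hM0, mul_comm]
    exact hterm m hm
  rw [Finset.sum_const, nsmul_eq_mul] at h7
  refine h7.trans ?_
  have hmscard' : (ms.card : ℝ) ≤ M := by exact_mod_cast hmscard
  calc (ms.card : ℝ) * (R ^ du * r k ^ (-a) / M) ≤ M * (R ^ du * r k ^ (-a) / M) :=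
        mul_le_mul_of_nonneg_right hmscard' (by positivity)
    _ = _ := by field_simp

theorem good_ae {G : SimpleGraph V} (hG : G.Connected) {du cu dl cl : ℝ}
    (hcu : 0 < cu) (hcl : 0 < cl) (hV : VolUpper G du cu) (hL : VolLower G dl cl)
    {r : ℕ → ℝ} (hr : Scales r) {M J : ℕ} {P : Measure (V → Bool)} [IsProbabilityMeasure P] {α cα a : ℝ}
    (hcα : 0 < cα) (hD : Decoupling G P α cα)
    (hP : ProbCond r M J du (cu * 4 ^ du * 3 ^ dl / cl) dl cα α a)
    (hbase : ∀ y, P.real {ω | ω y = false} ≤ r 0 ^ (-a) / cu)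
    (hsum : Summable fun j => r (j + M) ^ du * r j ^ (-a)) (o : V) :
    ∀ᵐ ω ∂P, ∃ k0, ∀ j, k0 ≤ j → ∀ y, (G.dist o y : ℝ) ≤ r (j + M) → ¬ NB G r M J ω j y := by
  classical
  obtain ⟨c, hc⟩ := exists_cells hG hr
  have main := main_induction hG hcu hcl hV hL hr hcα hD hc hP hbase
  let Bd : ℕ → Set (V → Bool) := fun j => {ω | ∃ y, (G.dist o y : ℝ) ≤ r (j + M) ∧ NB G r M J ω j y}
  have hB : ∀ j, P.real (Bd j) ≤ r (j + M) ^ du * r j ^ (-a) := by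
    intro j
    set S := (dist_fin hG hV o (r (j + M))).toFinset with hS
    have h1 := Ecell_union P (Zset G r M J j) (c j) S
    have h2 := main j o (r (j + M)) S (hr.mono (by omega)) (fun y hy => by simpa [hS] using hy)
    refine le_trans ?_ (h1.trans h2)
    refine measureReal_mono ?_ (measure_ne_top _ _)
    rintro ω ⟨y, hy, hNB⟩
    exact ⟨y, by simpa [hS] using hy, hNB⟩
  have hne : ∑' j, P (Bd j) ≠ ⊤ := by
    have h1 : ∀ j, P (Bd j) ≤ ENNReal.ofReal (r (j + M) ^ du * r j ^ (-a)) := by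
      intro j
      rw [← ENNReal.ofReal_toReal (measure_ne_top P (Bd j))]
      exact ENNReal.ofReal_le_ofReal (hB j)
    refine ne_top_of_le_ne_top ?_ (ENNReal.tsum_le_tsum h1)
    exact hsum.tsum_ofReal_ne_top
  have := ae_eventually_notMem hne
  filter_upwards [this] with ω hω
  rw [Filter.eventually_atTop] at hω
  obtain ⟨k0, hk0⟩ := hω
  exact ⟨k0, fun j hj y hy hNB => hk0 j hj ⟨y, hy, hNB⟩⟩

end Step


section Params

theorem ev_pow (C p q : ℝ) (h : p < q) : ∀ᶠ x : ℝ in atTop, C * x ^ p ≤ x ^ q := by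
  have h1 := (tendsto_rpow_atTop (sub_pos.2 h)).eventually (eventually_ge_atTop C)
  filter_upwards [h1, eventually_gt_atTop 0] with x hx hx0
  have h2 : x ^ q = x ^ (q - p) * x ^ p := by rw [← Real.rpow_add hx0]; congr 1; ring
  rw [h2]
  exact mul_le_mul_of_nonneg_right hx (by positivity)

theorem exists_params (di ci du cu dl C1 cα α : ℝ) (hdi : 1 < di) (hci : 0 < ci) (hdu : 1 ≤ du)
    (hC1 : 0 ≤ C1) (hcα : 0 < cα)
    (hα : (max 1 (di * (du - 1) / (di - 1))) * du - dl < α) :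
    ∃ (M J : ℕ) (r : ℕ → ℝ) (a : ℝ), Scales r ∧ IsoCond r M J di ci du cu ∧
      ProbCond r M J du C1 dl cα α a ∧ Summable (fun j => r (j + M) ^ du * r j ^ (-a)) := by
  have hdu0 : 0 < du := by linarith
  obtain ⟨A, hA⟩ : ∃ A, A = α + dl := ⟨_, rfl⟩
  obtain ⟨γ2, hg1, hg2⟩ : ∃ γ2, max 1 (di * (du - 1) / (di - 1)) < γ2 ∧ γ2 < A / du :=
    exists_between (by rw [lt_div_iff₀ hdu0]; linarith)
  have hg3 : 1 < γ2 := lt_of_le_of_lt (le_max_left _ _) hg1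
  have hg4 : di * (du - 1) / (di - 1) < γ2 := lt_of_le_of_lt (le_max_right _ _) hg1
  have hg0 : 0 < γ2 := by linarith
  rw [lt_div_iff₀ hdu0] at hg2
  have hA0 : 0 < A := by nlinarith
  -- the ratio
  have hrat : 1 < A / (γ2 * du) := by rw [lt_div_iff₀ (by positivity)]; linarith
  obtain ⟨κ, hκ⟩ : ∃ κ, κ = (A / (γ2 * du)) ^ ((1:ℝ) / 4) := ⟨_, rfl⟩
  have hκ1 : 1 < κ := by rw [hκ]; exact Real.one_lt_rpow hrat (by norm_num)
  have hκ4 : κ ^ 4 = A / (γ2 * du) := by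
    rw [hκ, ← Real.rpow_natCast, ← Real.rpow_mul (by linarith)]; norm_num
  obtain ⟨N, hN⟩ := pow_unbounded_of_one_lt γ2 hκ1
  have hN1 : N ≠ 0 := by rintro rfl; simp at hN; linarith
  obtain ⟨β, hβ⟩ : ∃ β, β = γ2 ^ ((N:ℝ)⁻¹) := ⟨_, rfl⟩
  have hβN : β ^ N = γ2 := by rw [hβ]; exact Real.rpow_inv_natCast_pow hg0.le hN1
  have hβ1 : 1 < β := by
    rw [hβ]; exact Real.one_lt_rpow hg3 (by positivity)
  have hβκ : β < κ := by
    by_contra hcon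
    push Not at hcon
    have := pow_le_pow_left₀ (by linarith) hcon N
    rw [hβN] at this
    linarith
  have hβ4 : β ^ 4 * (γ2 * du) < A := by
    have h1 : β ^ 4 < κ ^ 4 := pow_lt_pow_left₀ hβκ (by linarith) (by norm_num)
    rw [hκ4, lt_div_iff₀ (by positivity)] at h1
    exact h1
  obtain ⟨M, hM⟩ : ∃ M, M = N + 2 := ⟨_, rfl⟩
  obtain ⟨γ, hγ⟩ : ∃ γ, γ = β ^ M := ⟨_, rfl⟩
  have hγ' : γ = γ2 * β ^ 2 := by rw [hγ, hM, pow_add, hβN]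
  have hβ0 : 0 < β := by linarith
  obtain ⟨a, ha1, ha2⟩ : ∃ a, γ * du < a ∧ a < A / β ^ 2 := by
    refine exists_between ?_
    rw [lt_div_iff₀ (by positivity), hγ']
    calc _ = β ^ 4 * (γ2 * du) := by ring
      _ < A := hβ4
  rw [lt_div_iff₀ (by positivity)] at ha2
  have hγ0 : 0 < γ := by rw [hγ]; positivity
  have ha0 : 0 < a := lt_trans (by positivity) ha1
  obtain ⟨η, hη⟩ : ∃ η, η = a - γ * du := ⟨_, rfl⟩
  have hη0 : 0 < η := by rw [hη]; linarith
  obtain ⟨J, hJ⟩ := exists_nat_ge (γ * a / η)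
  have hJpos : 1 ≤ J := by
    have h1 : 0 < γ * a / η := by positivity
    have : (0:ℝ) < J := by linarith
    exact_mod_cast this
  rw [div_le_iff₀ hη0] at hJ
  obtain ⟨n0, hn0⟩ : ∃ n0 : ℕ, n0 = (1 + J ^ M) ^ M := ⟨_, rfl⟩
  obtain ⟨θ, hθ⟩ : ∃ θ, θ = (di - 1) / di := ⟨_, rfl⟩
  have hdiff : du - 1 < γ2 * θ := by
    rw [div_lt_iff₀ (by linarith)] at hg4
    rw [hθ, mul_div_assoc', lt_div_iff₀ (by linarith)]
    linarith
  obtain ⟨C4, hC4⟩ : ∃ C4, C4 = n0 * (cu ^ 2 * 3 ^ du * 2 ^ (du - 1)) * 4 ^ θ / ci + 1 := ⟨_, rfl⟩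
  obtain ⟨C', hC'⟩ : ∃ C', C' = 2 * C1 * cα * 6 ^ (-α) := ⟨_, rfl⟩
  have hC'0 : 0 ≤ C' := by rw [hC']; positivity
  have ev := ((eventually_ge_atTop (3:ℝ)).and <| (ev_pow 24 1 β hβ1).and <|
    (ev_pow (2 * M) 1 β hβ1).and <| (ev_pow (44 * n0) 1 γ2 hg3).and <|
    (ev_pow C4 (du - 1) (γ2 * θ) hdiff).and <| (ev_pow (2 * 3 ^ du) (-η) 0 (by linarith)).and <|
    (ev_pow (3 * M * 3 ^ (du * J)) (-a) 0 (by linarith)).and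
    (ev_pow (3 * M * C') (-A) (-(a * β ^ 2)) (by linarith)))
  obtain ⟨L, hL⟩ := eventually_atTop.1 ev
  obtain ⟨L', hL'⟩ : ∃ L', L' = max L 3 := ⟨_, rfl⟩
  have hL3 : 3 ≤ L' := hL' ▸ le_max_right _ _
  have hLL : L ≤ L' := hL' ▸ le_max_left _ _
  obtain ⟨r, hr⟩ : ∃ r : ℕ → ℝ, ∀ k, r k = L' ^ (β ^ k) := ⟨_, fun _ => rfl⟩
  have hrL : ∀ k, L' ≤ r k := by
    intro k
    rw [hr]
    exact Real.self_le_rpow_of_one_le (by linarith) (one_le_pow₀ hβ1.le)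
  have hr3 : ∀ k, 3 ≤ r k := fun k => hL3.trans (hrL k)
  have hr1 : ∀ k, 1 ≤ r k := fun k => by have := hr3 k; linarith
  have hr0 : ∀ k, 0 < r k := fun k => by have := hr3 k; linarith
  have hadd : ∀ k i, r (k + i) = r k ^ (β ^ i) := by
    intro k i
    rw [hr, hr, ← Real.rpow_mul (by linarith), pow_add]
  have hE := fun k => hL (r k) (hLL.trans (hrL k))
  have hsucc : ∀ k, r (k + 1) = r k ^ β := fun k => by rw [hadd, pow_one]
  have hS : Scales r := by
    refine ⟨hr3, fun k => ?_⟩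
    have := (hE k).2.1
    rwa [Real.rpow_one, ← hsucc] at this
  have hM2 : ∀ m, r (m + M - 1) = r (m + 1) ^ γ2 := by
    intro m
    rw [show m + M - 1 = (m + 1) + N by omega, hadd, hβN]
  have hMγ : ∀ m, r (m + M) = r m ^ γ := fun m => by rw [hadd, hγ]
  have he : ∀ m k, m + 2 ≤ k → k ≤ m + M → (3 * r k) ^ du * r m ^ (-a) ≤ 3 ^ du * r m ^ (-η) := by
    intro m k h1 h2
    have h3 : r k ≤ r m ^ γ := by rw [← hMγ]; exact hS.mono h2
    have h4 : (3 * r k) ^ du ≤ 3 ^ du * r m ^ (γ * du) := by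
      rw [Real.mul_rpow (by norm_num) (hr0 k).le, Real.rpow_mul (hr0 m).le]
      refine mul_le_mul_of_nonneg_left (Real.rpow_le_rpow (hr0 k).le h3 hdu0.le) (by positivity)
    calc _ ≤ 3 ^ du * r m ^ (γ * du) * r m ^ (-a) :=
          mul_le_mul_of_nonneg_right h4 (Real.rpow_nonneg (hr0 m).le _)
      _ = _ := by rw [mul_assoc, ← Real.rpow_add (hr0 m)]; congr 2; rw [hη]; ring
  have hq1 : ∀ m k, m + 2 ≤ k → k ≤ m + M → (3 * r k) ^ du * r m ^ (-a) ≤ 1 / 2 := by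
    intro m k h1 h2
    have h3 := (hE m).2.2.2.2.2.1
    rw [Real.rpow_zero] at h3
    have := he m k h1 h2
    linarith
  refine ⟨M, J, r, a, hS, ⟨by omega, hJpos, ?_, ?_, ?_⟩, ⟨hq1, ?_⟩, ?_⟩
  · intro k
    have := (hE k).2.2.1
    rwa [Real.rpow_one, ← hsucc] at this
  · intro m
    have h1 := (hE (m + 1)).2.2.2.1
    rw [← hM2, Real.rpow_one] at h1
    rw [← hn0]
    have h2 := hr1 (m + 1)
    have h3 : (0:ℝ) ≤ n0 := by positivity
    nlinarith
  · intro m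
    have h1 := (hE (m + 1)).2.2.2.2.1
    rw [← hn0, hM2, ← hθ]
    have hy := hr0 (m + 1)
    generalize r (m + 1) = y at *
    have e1 : (y ^ γ2 / 2 / 2) ^ θ = y ^ (γ2 * θ) / 4 ^ θ := by
      rw [div_div, Real.div_rpow (by positivity) (by norm_num), Real.rpow_mul hy.le]; norm_num
    rw [e1, Real.mul_rpow (by norm_num) hy.le]
    have e2 : 0 < y ^ (du - 1) := Real.rpow_pos_of_pos hy _
    have e3 : n0 * (cu ^ 2 * 3 ^ du * 2 ^ (du - 1)) * 4 ^ θ / ci * y ^ (du - 1) < y ^ (γ2 * θ) := by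
      rw [hC4] at h1; linarith
    have e4 : (0:ℝ) < 4 ^ θ := by positivity
    have e5 := mul_lt_mul_of_pos_left e3 (div_pos hci e4)
    calc _ = ci / 4 ^ θ * (n0 * (cu ^ 2 * 3 ^ du * 2 ^ (du - 1)) * 4 ^ θ / ci * y ^ (du - 1)) := by
          field_simp
      _ < _ := e5
      _ = _ := by ring
  · intro m k h1 h2
    have hE6 := (hE m).2.2.2.2.2.2.1
    have hE7 := (hE (k - 2)).2.2.2.2.2.2.2
    have he' := he m k h1 h2
    have hq1' := hq1 m k h1 h2
    have hyγ : r k ≤ r m ^ γ := by rw [← hMγ]; exact hS.mono h2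
    have hyX : r k = r (k - 2) ^ (β ^ 2) := by rw [← hadd]; congr 1; omega
    have hx1 := hr1 m
    have hX0 := hr0 (k - 2)
    have hy0 := hr0 k
    have hx0 := hr0 m
    generalize r m = x at *
    generalize r k = y at *
    generalize r (k - 2) = X at *
    have hM0 : (0:ℝ) ≤ M := by positivity
    have hxa : 0 < x ^ (-a) := Real.rpow_pos_of_pos hx0 _
    have e0 : 0 ≤ (3 * y) ^ du * x ^ (-a) := by positivity
    -- first term
    have t1 : 3 * (M * (x ^ (-a) * ((3 * y) ^ du * x ^ (-a)) ^ J)) ≤ y ^ (-a) := by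
      have a1 : ((3 * y) ^ du * x ^ (-a)) ^ J ≤ 3 ^ (du * J) * x ^ (-(γ * a)) := by
        refine (pow_le_pow_left₀ e0 he' J).trans ?_
        rw [mul_pow, ← Real.rpow_natCast, ← Real.rpow_natCast, ← Real.rpow_mul (by norm_num),
          ← Real.rpow_mul hx0.le]
        refine mul_le_mul_of_nonneg_left (Real.rpow_le_rpow_of_exponent_le hx1 ?_) (by positivity)
        linarith
      have a2 : x ^ (-(γ * a)) ≤ y ^ (-a) := by
        rw [Real.rpow_neg hx0.le, Real.rpow_neg hy0.le, Real.rpow_mul hx0.le]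
        exact inv_anti₀ (Real.rpow_pos_of_pos hy0 _) (Real.rpow_le_rpow hy0.le hyγ ha0.le)
      have a3 : 0 < x ^ (-(γ * a)) := Real.rpow_pos_of_pos hx0 _
      rw [Real.rpow_zero] at hE6
      calc _ ≤ 3 * (M * (x ^ (-a) * (3 ^ (du * J) * x ^ (-(γ * a))))) := by gcongr
        _ = (3 * M * 3 ^ (du * J) * x ^ (-a)) * x ^ (-(γ * a)) := by ring
        _ ≤ 1 * x ^ (-(γ * a)) := mul_le_mul_of_nonneg_right hE6 a3.le
        _ ≤ _ := by linarith
    have hXA : X ^ (-dl) * (cα * (6 * X) ^ (-α)) = cα * 6 ^ (-α) * X ^ (-A) := by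
      rw [Real.mul_rpow (by norm_num) hX0.le, hA]
      have : X ^ (-(α + dl)) = X ^ (-dl) * X ^ (-α) := by
        rw [← Real.rpow_add hX0]; congr 1; ring
      rw [this]; ring
    have hyXa : y ^ (-a) = X ^ (-(a * β ^ 2)) := by
      rw [hyX, ← Real.rpow_mul hX0.le]; congr 1; ring
    have hXAn : 0 < X ^ (-A) := Real.rpow_pos_of_pos hX0 _
    have h6 : (0:ℝ) < 6 ^ (-α) := by positivity
    have t2 : 3 * (M * (C' * X ^ (-A))) ≤ y ^ (-a) := by
      rw [hyXa]; linarith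
    have t3 : x ^ (-a) * (2 * (C1 * (3 * y) ^ du * X ^ (-dl)) * (cα * (6 * X) ^ (-α))) ≤ C' * X ^ (-A) := by
      calc _ = ((3 * y) ^ du * x ^ (-a)) * (2 * C1 * (X ^ (-dl) * (cα * (6 * X) ^ (-α)))) := by ring
        _ = ((3 * y) ^ du * x ^ (-a)) * (C' * X ^ (-A)) := by rw [hXA, hC']; ring
        _ ≤ 1 * (C' * X ^ (-A)) := mul_le_mul_of_nonneg_right (by linarith) (by positivity)
        _ = _ := one_mul _
    have t4 : C1 * X ^ (-dl) * (cα * (6 * X) ^ (-α)) ≤ C' * X ^ (-A) := by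
      have a1 : C1 * X ^ (-dl) * (cα * (6 * X) ^ (-α)) = C1 * (cα * 6 ^ (-α) * X ^ (-A)) := by
        rw [← hXA]; ring
      have a2 : 0 ≤ C1 * (cα * 6 ^ (-α) * X ^ (-A)) := by positivity
      rw [a1, hC']; linarith
    have t3' := mul_le_mul_of_nonneg_left t3 hM0
    have t4' := mul_le_mul_of_nonneg_left t4 hM0
    calc _ = M * (x ^ (-a) * ((3 * y) ^ du * x ^ (-a)) ^ J) +
          M * (x ^ (-a) * (2 * (C1 * (3 * y) ^ du * X ^ (-dl)) * (cα * (6 * X) ^ (-α)))) +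
          M * (C1 * X ^ (-dl) * (cα * (6 * X) ^ (-α))) := by ring
      _ ≤ _ := by linarith
  · have hgeo : Summable fun j : ℕ => ((2:ℝ) ^ (-η)) ^ j := by
      refine summable_geometric_of_lt_one (by positivity) ?_
      exact Real.rpow_lt_one_of_one_lt_of_neg (by norm_num) (by linarith)
    refine Summable.of_nonneg_of_le (fun j => ?_) (fun j => ?_) hgeo
    · have := hr0 j
      have := hr0 (j + M)
      positivity
    · rw [hMγ, ← Real.rpow_mul (hr0 j).le, ← Real.rpow_add (hr0 j)]
      have e1 : γ * du + -a = -η := by rw [hη]; ring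
      have e2 : ((2:ℝ) ^ (-η)) ^ j = ((2:ℝ) ^ j) ^ (-η) := by
        rw [← Real.rpow_natCast, ← Real.rpow_mul (by norm_num), ← Real.rpow_natCast,
          ← Real.rpow_mul (by norm_num), mul_comm]
      rw [e1, e2]
      exact Real.rpow_le_rpow_of_nonpos (by positivity) (hS.pow_le j) (by linarith)

end Params

/-- dependent percolation with polynomial decoupling: uniqueness of the
infinite cluster for environments with high enough density. -/
theorem statement3 :
    ∀ (di ci du cu dl cl cα α : ℝ), 1 < di → 0 < ci → 1 ≤ du → 0 < cu → 1 ≤ dl →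
      0 < cl → 0 < cα → (max 1 (di * (du - 1) / (di - 1))) * du - dl < α →
    ∃ pstar : ℝ, pstar < 1 ∧
      ∀ (V : Type u) (G : SimpleGraph V), Infinite V → G.Connected →
        (∀ v : V, (G.neighborSet v).Finite) →
        LocalIso G di ci → VolUpper G du cu → VolLower G dl cl →
        ∀ P : Measure (V → Bool), IsProbabilityMeasure P → Decoupling G P α cα →
          pstar < ⨅ x : V, (P {ω | ω x = true}).toReal →
          P {ω | UniqueInfCluster G ω} = 1 := by
  intro di ci du cu dl cl cα α hdi hci hdu hcu hdl hcl hcα hα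
  obtain ⟨M, J, r, a, hr, hC, hP, hsum⟩ :=
    exists_params di ci du cu dl (cu * 4 ^ du * 3 ^ dl / cl) cα α hdi hci hdu (by positivity) hcα hα
  have hr0 : 0 < r 0 := by linarith [hr.three 0]
  refine ⟨1 - r 0 ^ (-a) / cu, ?_, ?_⟩
  · have : 0 < r 0 ^ (-a) / cu := by positivity
    linarith
  intro V G hinf hG _ hI hV hL P hPr hD hinf'
  have hbase : ∀ y, P.real {ω | ω y = false} ≤ r 0 ^ (-a) / cu := by
    intro y
    have h1 : (⨅ x : V, (P {ω | ω x = true}).toReal) ≤ (P {ω | ω y = true}).toReal :=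
      ciInf_le ⟨0, by rintro _ ⟨x, rfl⟩; exact ENNReal.toReal_nonneg⟩ y
    have hm : MeasurableSet {ω : V → Bool | ω y = true} :=
      (measurable_pi_apply (X := fun _ : V => Bool) y) (MeasurableSet.singleton true)
    have h2 : {ω : V → Bool | ω y = false} = {ω : V → Bool | ω y = true}ᶜ := by
      ext ω; simp
    rw [h2, probReal_compl_eq_one_sub hm]
    have h3 : P.real {ω | ω y = true} = (P {ω | ω y = true}).toReal := rfl
    linarith
  obtain ⟨o⟩ := hG.nonempty
  have hae : ∀ᵐ ω ∂P, UniqueInfCluster G ω := by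
    filter_upwards [good_ae hG hcu hcl hV hL hr hcα hD hP hbase hsum o] with ω hω
    exact unique_of_X hG hV o (lemmaX hG hdi hci hcu hV hI hr hC o hω)
  rw [measure_congr (show {ω | UniqueInfCluster G ω} =ᵐ[P] Set.univ from
    eventuallyEq_univ.2 hae), measure_univ]
end

section
/- Let G = (V,E) be a graph, fix γ > 1 and set L_0 = 10000, L_{k+1} = L_k^γ. Let x ∈ V and let k ≥ 1 be such that 2000·L_k < L_{k+1}. Let ω : V → {0,1} be a configuration for which the separation event S(x, L_{k+1}) occurs. Let K ⊆ B(x, 5L_{k+1}/6) be a set such that B(x, 4L_{k+1}/6) ⊆ B(K, L_k/6), and let A, B be sets such that: (a) A and B are connected and contained in B(x, 3L_{k+1}/6); (b) both have diameter at least L_{k+1}/1000; and (c) no open path with all vertices in B(x, L_{k+1}) connects A to B. Then for every path σ with all vertices in B(x, 4L_{k+1}/6) that connects A to B, there exists y ∈ K such that σ has a vertex in B(y, L_k/6) and the separation event S(y, L_k) occurs. -/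
open MeasureTheory Filter

universe u

variable {V : Type u}

/-- walk inside a set -/
def walkIn (G : SimpleGraph V) (S : Set V) (u v : V) : Prop :=
  ∃ p : G.Walk u v, ∀ z ∈ p.support, z ∈ S

theorem walkIn.trans {G : SimpleGraph V} {S : Set V} {u v w : V}
    (h1 : walkIn G S u v) (h2 : walkIn G S v w) : walkIn G S u w := by
  obtain ⟨p, hp⟩ := h1
  obtain ⟨q, hq⟩ := h2
  refine ⟨p.append q, fun z hz => ?_⟩
  rw [SimpleGraph.Walk.mem_support_append_iff] at hz
  exact hz.elim (hp z) (hq z)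

theorem walkIn.symm {G : SimpleGraph V} {S : Set V} {u v : V}
    (h1 : walkIn G S u v) : walkIn G S v u := by
  obtain ⟨p, hp⟩ := h1
  exact ⟨p.reverse, fun z hz => hp z (by simpa using hz)⟩

theorem walkIn.mono {G : SimpleGraph V} {S T : Set V} {u v : V}
    (h1 : walkIn G S u v) (h : S ⊆ T) : walkIn G T u v := by
  obtain ⟨p, hp⟩ := h1
  exact ⟨p, fun z hz => h (hp z hz)⟩

theorem walkIn.left {G : SimpleGraph V} {S : Set V} {u v : V}
    (h1 : walkIn G S u v) : u ∈ S := by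
  obtain ⟨p, hp⟩ := h1
  exact hp _ p.start_mem_support

theorem walkIn_of_conn {G : SimpleGraph V} {S : Set V} (h : ConnSet G S) {u v : V}
    (hu : u ∈ S) (hv : v ∈ S) : walkIn G S u v := by
  obtain ⟨p⟩ := h.preconnected ⟨u, hu⟩ ⟨v, hv⟩
  have key : ∀ (s t : S), (G.induce S).Walk s t → walkIn G S s.1 t.1 := by
    intro s t q
    induction q with
    | @nil s => exact ⟨SimpleGraph.Walk.nil, fun z hz => by simp at hz; subst hz; exact s.2⟩
    | @cons s s' t e q ih =>
      obtain ⟨r, hr⟩ := ih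
      have e' : G.Adj s.1 s'.1 := e
      refine ⟨SimpleGraph.Walk.cons e' r, fun z hz => ?_⟩
      simp at hz
      rcases hz with rfl | hz
      · exact s.2
      · exact hr z hz
  exact key _ _ p

theorem walkIn_of_ball {G : SimpleGraph V} {S : Set V} {u v : V}
    (hu : u ∈ S) (hv : v ∈ S) (h : v ∈ gball G u 1) : walkIn G S u v := by
  obtain ⟨p, hp⟩ := h
  refine ⟨p, fun z hz => ?_⟩
  have hp : p.length ≤ 1 := by exact_mod_cast hp
  cases p with
  | nil => simp at hz; rwa [hz]
  | cons e q =>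
    cases q with
    | nil =>
      simp at hz
      rcases hz with rfl | rfl <;> assumption
    | cons e' q' => simp at hp

theorem gball_self {G : SimpleGraph V} {u : V} {r : ℝ} (hr : 0 ≤ r) : u ∈ gball G u r :=
  ⟨SimpleGraph.Walk.nil, by simpa using hr⟩

theorem gball_symm {G : SimpleGraph V} {u v : V} {r : ℝ} (h : v ∈ gball G u r) :
    u ∈ gball G v r := by
  obtain ⟨p, hp⟩ := h
  exact ⟨p.reverse, by simpa using hp⟩

theorem gball_trans {G : SimpleGraph V} {u v w : V} {r s t : ℝ} (h : v ∈ gball G u r)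
    (h' : w ∈ gball G v s) (ht : r + s ≤ t) : w ∈ gball G u t := by
  obtain ⟨p, hp⟩ := h
  obtain ⟨q, hq⟩ := h'
  refine ⟨p.append q, ?_⟩
  rw [SimpleGraph.Walk.length_append]
  push_cast
  linarith

theorem distGE_symm {G : SimpleGraph V} {u v : V} {r : ℝ} (h : distGE G u v r) :
    distGE G v u r := fun p => by simpa using h p.reverse

theorem distGE_mono {G : SimpleGraph V} {u v : V} {r s : ℝ} (h : distGE G u v r) (hs : s ≤ r) :
    distGE G u v s := fun p => hs.trans (h p)

theorem not_distGE {G : SimpleGraph V} {u v : V} {r : ℝ} (h : ¬ distGE G u v r) :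
    v ∈ gball G u r := by
  unfold distGE at h
  push Not at h
  obtain ⟨p, hp⟩ := h
  exact ⟨p, hp.le⟩

theorem distGE_ball {G : SimpleGraph V} {u v : V} {r s : ℝ} (h : distGE G u v r)
    (h' : v ∈ gball G u s) : r ≤ s := by
  obtain ⟨p, hp⟩ := h'
  exact (h p).trans hp

/-- a connected piece of a set -/
theorem piece_aux {G : SimpleGraph V} {H : Set V} {c : V} {r : ℝ} {a w : V}
    (q : G.Walk a w) (hq : ∀ z ∈ q.support, z ∈ H) (hw : distGE G c w r)
    (ha : a ∈ gball G c (r + 1)) :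
    ∃ u, walkIn G (H ∩ gball G c (r + 1)) a u ∧ distGE G c u r := by
  induction q with
  | nil =>
    exact ⟨_, ⟨SimpleGraph.Walk.nil, fun z hz => by
      simp at hz; subst hz; exact ⟨hq _ (by simp), ha⟩⟩, hw⟩
  | @cons a b w e q ih =>
    by_cases hd : distGE G c a r
    · exact ⟨a, ⟨SimpleGraph.Walk.nil, fun z hz => by
        simp at hz; subst hz; exact ⟨hq _ (by simp), ha⟩⟩, hd⟩
    · have hb : b ∈ gball G c (r + 1) :=
        gball_trans (not_distGE hd) (⟨e.toWalk, by simp⟩ : b ∈ gball G a 1) le_rfl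
      obtain ⟨u, ⟨p, hp⟩, hu⟩ := ih (fun z hz => hq z (by simp [hz])) hw hb
      refine ⟨u, ⟨SimpleGraph.Walk.cons e p, fun z hz => ?_⟩, hu⟩
      simp at hz
      rcases hz with rfl | hz
      · exact ⟨hq _ (by simp), ha⟩
      · exact hp z hz

theorem piece {G : SimpleGraph V} {H : Set V} {c w : V} {r : ℝ} (hr : 0 ≤ r)
    (hcw : walkIn G H c w) (hw : distGE G c w r) :
    ∃ P ⊆ H, ConnSet G P ∧ P ⊆ gball G c (r + 1) ∧ c ∈ P ∧ ∃ u ∈ P, distGE G c u r := by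
  obtain ⟨q, hq⟩ := hcw
  obtain ⟨u, ⟨p, hp⟩, hu⟩ := piece_aux q hq hw (gball_self (by linarith))
  exact ⟨{z | z ∈ p.support}, fun z hz => (hp z hz).1, p.connected_induce_support,
    fun z hz => (hp z hz).2, p.start_mem_support, u, p.end_mem_support, hu⟩

theorem gnbhd_mono {G : SimpleGraph V} {A B : Set V} {r : ℝ} (h : A ⊆ B) :
    gnbhd G A r ⊆ gnbhd G B r := fun _ ⟨x, hx, hy⟩ => ⟨x, h hx, hy⟩

theorem connectsIn_mono {G : SimpleGraph V} {ω : V → Bool} {A A' B B' S : Set V}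
    (h : ConnectsIn G ω A B S) (hA : A ⊆ A') (hB : B ⊆ B') : ConnectsIn G ω A' B' S := by
  obtain ⟨a, b, p, ha, hb, h1, h2⟩ := h
  exact ⟨a, b, p, gnbhd_mono hA ha, gnbhd_mono hB hb, h1, h2⟩

theorem split {G : SimpleGraph V} {ω : V → Bool} {y : V} {L : ℝ} (hL : 10000 ≤ L)
    (hs : ¬ sep G ω y L) {P Q : Set V} (hP : ConnSet G P) (hQ : ConnSet G Q)
    (hPy : P ⊆ gball G y (3 * L / 6)) (hQy : Q ⊆ gball G y (3 * L / 6))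
    (hPd : diamGE G P (L / 10)) (hQd : diamGE G Q (L / 100)) :
    ConnectsIn G ω P Q (gball G y L) := by
  obtain ⟨h, hh, u, hu, hhu⟩ := hPd
  obtain ⟨e, he, f, hf, hef⟩ := hQd
  have h0 : 0 ≤ L / 100 := by linarith
  obtain ⟨Q1, hQ1, cQ1, bQ1, eQ1, f', hf', hef'⟩ := piece h0 (walkIn_of_conn hQ he hf) hef
  obtain ⟨P1, hP1, cP1, bP1, eP1, g1, hg1, hhg1⟩ := piece h0 (walkIn_of_conn hP hh hu)
    (distGE_mono hhu (by linarith : L / 100 ≤ L / 10))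
  obtain ⟨P2, hP2, cP2, bP2, eP2, g2, hg2, hhg2⟩ := piece h0 (walkIn_of_conn hP hu hh)
    (distGE_mono (distGE_symm hhu) (by linarith : L / 100 ≤ L / 10))
  by_contra hcon
  have k1 : ¬ setDistGE G P1 Q1 2 := fun hd => hs
    ⟨P1, Q1, hP1.trans hPy, hQ1.trans hQy, cP1, cQ1, hd, ⟨h, eP1, g1, hg1, hhg1⟩,
      ⟨e, eQ1, f', hf', hef'⟩, fun hc => hcon (connectsIn_mono hc hP1 hQ1)⟩
  have k2 : ¬ setDistGE G P2 Q1 2 := fun hd => hs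
    ⟨P2, Q1, hP2.trans hPy, hQ1.trans hQy, cP2, cQ1, hd, ⟨u, eP2, g2, hg2, hhg2⟩,
      ⟨e, eQ1, f', hf', hef'⟩, fun hc => hcon (connectsIn_mono hc hP2 hQ1)⟩
  unfold setDistGE at k1 k2
  push Not at k1 k2
  obtain ⟨a1, ha1, b1, hb1, d1⟩ := k1
  obtain ⟨a2, ha2, b2, hb2, d2⟩ := k2
  have t1 := gball_trans (gball_trans (bP1 ha1) (not_distGE d1) le_rfl)
    (gball_symm (bQ1 hb1)) le_rfl
  have t2 := gball_trans (gball_trans (bP2 ha2) (not_distGE d2) le_rfl)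
    (gball_symm (bQ1 hb2)) le_rfl
  have := distGE_ball hhu (gball_trans t1 (gball_symm t2) le_rfl)
  linarith

theorem far_point_s8 {G : SimpleGraph V} {A : Set V} {L : ℝ} (hA : diamGE G A (2 * L)) (hL : 0 < L)
    (h : V) : ∃ w ∈ A, distGE G h w (L / 10) := by
  obtain ⟨y, hy, z, hz, hyz⟩ := hA
  by_contra hcon
  push Not at hcon
  have := distGE_ball hyz
    (gball_trans (gball_symm (not_distGE (hcon y hy))) (not_distGE (hcon z hz)) le_rfl)
  linarith

theorem Lseq_ge {γ : ℝ} (hγ : 1 < γ) (k : ℕ) : 10000 ≤ Lseq γ k := by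
  induction k with
  | zero => exact le_rfl
  | succ k ih =>
    refine ih.trans ?_
    change Lseq γ k ≤ Lseq γ k ^ γ
    exact Real.self_le_rpow_of_one_le (by linarith) hγ.le

theorem core {G : SimpleGraph V} {ω : V → Bool} {L : ℝ} (hL : 10000 ≤ L) {A B K S U : Set V}
    (hKU : ∀ y ∈ K, gball G y L ⊆ U)
    (hAU : A ⊆ U)
    (hAc : ConnSet G A) (hBc : ConnSet G B)
    (hAd : diamGE G A (2 * L)) (hBd : diamGE G B (2 * L))
    (hno : ¬ ConnectsIn G ω A B U)
    (hS : ∀ v ∈ S, ∃ y ∈ K, v ∈ gball G y (L / 6) ∧ ¬ sep G ω y L)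
    {a b : V} (p : G.Walk a b) (ha : a ∈ gnbhd G A 1) (hb : b ∈ gnbhd G B 1)
    (hp : ∀ v ∈ p.support, v ∈ S) : False := by
  have hL0 : 0 < L := by linarith
  let O : Set V := {v | v ∈ U ∧ ω v = true}
  let H : Set V := A ∪ {c | ∃ a ∈ gnbhd G A 1, walkIn G O a c}
  have hHA : ∀ u ∈ H, ∀ w ∈ A, walkIn G H u w := by
    rintro u (hu | ⟨a', ⟨a0, ha0, ha'⟩, hw⟩) w hwA
    · exact (walkIn_of_conn hAc hu hwA).mono Set.subset_union_left
    · have h1 : walkIn G H a' u := by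
        obtain ⟨q, hq⟩ := hw
        classical
        refine ⟨q, fun z hz => Or.inr ⟨a', ⟨a0, ha0, ha'⟩, q.takeUntil z hz, fun t ht => ?_⟩⟩
        exact hq t (q.support_takeUntil_subset_support hz ht)
      have h2 : walkIn G H a0 a' := walkIn_of_ball (Or.inl ha0) h1.left ha'
      exact (h1.symm.trans h2.symm).trans
        ((walkIn_of_conn hAc ha0 hwA).mono Set.subset_union_left)
  have hext : ∀ a' ∈ gnbhd G H 1, ∀ b', walkIn G O a' b' →
      ∃ a ∈ gnbhd G A 1, walkIn G O a b' := by
    rintro a' ⟨c, hc | ⟨a1, ha1, hw⟩, hca⟩ b' hab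
    · exact ⟨a', ⟨c, hc, hca⟩, hab⟩
    · exact ⟨a1, ha1, hw.trans ((walkIn_of_ball hw.symm.left hab.left hca).trans hab)⟩
  -- local connection
  have key : ∀ v ∈ S, (∃ h ∈ H, h ∈ gball G v (L / 20 + 1)) → ∀ Q : Set V, ConnSet G Q →
      Q ⊆ gball G v (L / 100 + 2) → diamGE G Q (L / 100) →
      ∃ b' ∈ gnbhd G Q 1, ∃ a ∈ gnbhd G A 1, walkIn G O a b' := by
    rintro v hv ⟨h, hh, hvh⟩ Q cQ bQ dQ
    obtain ⟨y, hyK, hyv, hns⟩ := hS v hv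
    obtain ⟨w, hwA, hw⟩ := far_point_s8 hAd hL0 h
    obtain ⟨P, hPH, cP, bP, hP, u, hu, hhu⟩ := piece (by linarith) (hHA h hh w hwA) hw
    obtain ⟨a', b', q, ha', hb', hq1, hq2⟩ := split hL hns cP cQ
      (fun z hz => gball_trans (gball_trans hyv hvh le_rfl) (bP hz) (by linarith))
      (fun z hz => gball_trans hyv (bQ hz) (by linarith)) ⟨h, hP, u, hu, hhu⟩ dQ
    exact ⟨b', hb', hext a' (gnbhd_mono hPH ha') b'
      ⟨q, fun z hz => ⟨hKU y hyK (hq1 z hz), hq2 z hz⟩⟩⟩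
  have good : ∀ v (q : G.Walk v a), (∀ z ∈ q.support, z ∈ S) →
      ∃ h ∈ H, h ∈ gball G v (L / 20) := by
    intro v q
    obtain ⟨a0, ha0, haa⟩ := ha
    induction q with
    | nil =>
      intro _
      exact ⟨a0, Or.inl ha0, gball_trans (gball_symm haa) (gball_self le_rfl) (by linarith)⟩
    | @cons v v' a e q ih =>
      intro hq
      by_contra hng
      obtain ⟨h, hh, hvh⟩ := ih p hp haa (fun z hz => hq z (by simp [hz]))
      have hvS : v ∈ S := hq v (by simp)
      have hvv : v' ∈ gball G v 1 := ⟨e.toWalk, by simp⟩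
      have hda : distGE G v a (L / 100) := by
        by_contra hd
        exact hng ⟨a0, Or.inl ha0, gball_trans (not_distGE hd) (gball_symm haa) (by linarith)⟩
      obtain ⟨Q, hQS, cQ, bQ, hQ, u, hu, hvu⟩ := piece (by linarith)
        (⟨SimpleGraph.Walk.cons e q, hq⟩ : walkIn G S v a) hda
      obtain ⟨b', ⟨c, hc, hcb⟩, hb''⟩ := key v hvS ⟨h, hh, gball_trans hvv hvh (by linarith)⟩ Q cQ
        (fun z hz => gball_trans (bQ hz) (gball_self le_rfl) (by linarith)) ⟨v, hQ, u, hu, hvu⟩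
      exact hng ⟨b', Or.inr hb'', gball_trans (bQ hc) hcb (by linarith)⟩
  obtain ⟨h, hh, hbh⟩ := good b p.reverse (fun z hz => hp z (by simpa using hz))
  obtain ⟨b0, hb0, hbb⟩ := hb
  obtain ⟨w, hwB, hw⟩ := far_point_s8 hBd hL0 b0
  obtain ⟨Q, hQB, cQ, bQ, hQ, u, hu, hvu⟩ := piece (by linarith)
    (walkIn_of_conn hBc hb0 hwB) (distGE_mono hw (by linarith : L / 100 ≤ L / 10))
  obtain ⟨b', hb', a', ha', q, hq⟩ := key b (hp b p.end_mem_support)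
    ⟨h, hh, gball_trans hbh (gball_self le_rfl) (by linarith)⟩ Q cQ
    (fun z hz => gball_trans (gball_symm hbb) (bQ hz) (by linarith)) ⟨b0, hQ, u, hu, hvu⟩
  exact hno ⟨a', b', q, ha', gnbhd_mono hQB hb', fun z hz => (hq z hz).1, fun z hz => (hq z hz).2⟩

/-- propagation of separation events to a smaller scale along any path
joining the sets `A` and `B`. -/
theorem statement8 {V : Type u} (G : SimpleGraph V) (γ : ℝ) (hγ : 1 < γ)
    (x : V) (k : ℕ) (hk : 1 ≤ k)
    (hscale : 2000 * Lseq γ k < Lseq γ (k + 1))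
    (ω : V → Bool) (hsep : sep G ω x (Lseq γ (k + 1)))
    (K : Set V) (hK : K ⊆ gball G x (5 * Lseq γ (k + 1) / 6))
    (hcov : gball G x (4 * Lseq γ (k + 1) / 6) ⊆ gnbhd G K (Lseq γ k / 6))
    (A B : Set V)
    (hAc : ConnSet G A) (hBc : ConnSet G B)
    (hAb : A ⊆ gball G x (3 * Lseq γ (k + 1) / 6))
    (hBb : B ⊆ gball G x (3 * Lseq γ (k + 1) / 6))
    (hAd : diamGE G A (Lseq γ (k + 1) / 1000))
    (hBd : diamGE G B (Lseq γ (k + 1) / 1000))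
    (hno : ¬ ConnectsIn G ω A B (gball G x (Lseq γ (k + 1)))) :
    ∀ (a b : V) (p : G.Walk a b), p.IsPath →
      a ∈ gnbhd G A 1 → b ∈ gnbhd G B 1 →
      (∀ v ∈ p.support, v ∈ gball G x (4 * Lseq γ (k + 1) / 6)) →
      ∃ y ∈ K, (∃ v ∈ p.support, v ∈ gball G y (Lseq γ k / 6)) ∧
        sep G ω y (Lseq γ k) := by
  intro a b p _ ha hb hp
  have hL := Lseq_ge hγ k
  by_contra hcon
  push Not at hcon
  refine core (K := K) (S := {v | v ∈ p.support}) (U := gball G x (Lseq γ (k + 1))) hL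
    ?_ ?_ hAc hBc ?_ ?_ hno ?_ p ha hb (fun v hv => hv)
  · exact fun y hy z hz => gball_trans (hK hy) hz (by linarith)
  · exact fun z hz => gball_trans (hAb hz) (gball_self le_rfl) (by linarith)
  · obtain ⟨y, hy, z, hz, h⟩ := hAd
    exact ⟨y, hy, z, hz, distGE_mono h (by linarith)⟩
  · obtain ⟨y, hy, z, hz, h⟩ := hBd
    exact ⟨y, hy, z, hz, distGE_mono h (by linarith)⟩
  · intro v hv
    obtain ⟨y, hy, hvy⟩ := hcov (hp v hv)
    exact ⟨y, hy, hvy, hcon y hy ⟨v, hv, hvy⟩⟩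
end
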